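/- arXiv:2007.06003 — 3 statements merged into one kernel-verified Lean document; each statement's English description precedes it below -/
import Mathlib

section
/- For every integer r ≥ 3 and integers n₁ ≥ n₂ ≥ ⋯ ≥ n_r ≥ 1, the anti-Ramsey number of the triangle C₃ in the complete r-partite graph K_{n₁,n₂,…,n_r} equals n₁n₂ + n₃n₄ + ⋯ + n_{r−2}n_{r−1} + n_r + (r−1)/2 − 1 when r is odd, and equals n₁n₂ + n₃n₄ + ⋯ + n_{r−1}n_r + r/2 − 1 when r is even. -/
open Finset

/-- The complete `r`-partite graph with parts of sizes `n 0, n 1, …, n (r-1)`. -/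
def Kpartite (r : ℕ) (n : ℕ → ℕ) : SimpleGraph ((i : Fin r) × Fin (n i)) :=
  SimpleGraph.completeMultipartiteGraph fun i : Fin r => Fin (n i)

/-- The edge-coloring `c` contains a rainbow 3-cycle in `G`. -/
def RainbowC3 {V α : Type*} (G : SimpleGraph V) (c : Sym2 V → α) : Prop :=
  ∃ a b d : V, G.Adj a b ∧ G.Adj b d ∧ G.Adj d a ∧
    c s(a, b) ≠ c s(b, d) ∧ c s(b, d) ≠ c s(d, a) ∧ c s(a, b) ≠ c s(d, a)

/-- The edge-coloring `c` contains a rainbow 4-cycle in `G`. -/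
def RainbowC4 {V α : Type*} (G : SimpleGraph V) (c : Sym2 V → α) : Prop :=
  ∃ a b d e : V, G.Adj a b ∧ G.Adj b d ∧ G.Adj d e ∧ G.Adj e a ∧
    a ≠ d ∧ b ≠ e ∧
    c s(a, b) ≠ c s(b, d) ∧ c s(a, b) ≠ c s(d, e) ∧ c s(a, b) ≠ c s(e, a) ∧
    c s(b, d) ≠ c s(d, e) ∧ c s(b, d) ≠ c s(e, a) ∧ c s(d, e) ≠ c s(e, a)

/-- The coloring `c` uses every one of the `k` colors on at least one edge of `G`
(i.e. it uses exactly `k` colors). -/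
def SurjOnEdges {V : Type*} {k : ℕ} (G : SimpleGraph V) (c : Sym2 V → Fin k) : Prop :=
  ∀ i : Fin k, ∃ e ∈ G.edgeSet, c e = i

/-- The contribution of a pair of parts of sizes `a` and `b` to the anti-Ramsey number: a pair of
nonempty parts contributes all of its edges and one further color, and a part paired with an empty
one contributes one color for each of its vertices. -/
def pairValue (a b : ℕ) : ℕ := if a = 0 ∨ b = 0 then a + b else a * b + 1

lemma pairValue_comm (a b : ℕ) : pairValue a b = pairValue b a := by
  unfold pairValue
  simp only [or_comm, add_comm, mul_comm]

lemma pairValue_zero_right (a : ℕ) : pairValue a 0 = a := by simp [pairValue]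

lemma pairValue_zero_left (a : ℕ) : pairValue 0 a = a := by simp [pairValue]

lemma pairValue_of_pos {a b : ℕ} (ha : 1 ≤ a) (hb : 1 ≤ b) : pairValue a b = a * b + 1 := by
  simp [pairValue]; omega

lemma add_le_pairValue (a b : ℕ) : a + b ≤ pairValue a b := by
  rcases Nat.eq_zero_or_pos a with rfl | ha
  · simp [pairValue_zero_left]
  rcases Nat.eq_zero_or_pos b with rfl | hb
  · simp [pairValue_zero_right]
  rw [pairValue_of_pos ha hb]
  nlinarith

lemma pairValue_succ_left (a b : ℕ) : pairValue a b + 1 ≤ pairValue (a + 1) b := by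
  rcases Nat.eq_zero_or_pos b with rfl | hb
  · simp [pairValue_zero_right]
  rcases Nat.eq_zero_or_pos a with rfl | ha
  · rw [pairValue_zero_left, pairValue_of_pos le_rfl hb]; omega
  rw [pairValue_of_pos ha hb, pairValue_of_pos (by omega) hb]
  nlinarith

lemma pairValue_exchange {a b c d : ℕ} (hba : b ≤ a) (hcb : c ≤ b) (hdb : d ≤ b) :
    pairValue a c + pairValue b d ≤ pairValue a b + pairValue c d := by
  rcases Nat.eq_zero_or_pos b with rfl | hb
  · obtain rfl : c = 0 := by omega
    obtain rfl : d = 0 := by omega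
    simp
  have hab := pairValue_of_pos (hb.trans_le hba) hb
  rcases Nat.eq_zero_or_pos c with rfl | hc
  · rw [pairValue_zero_right, pairValue_zero_left, hab]
    rcases Nat.eq_zero_or_pos d with rfl | hd
    · rw [pairValue_zero_right]; nlinarith
    · rw [pairValue_of_pos hb hd]
      obtain ⟨e, rfl⟩ := Nat.exists_eq_add_of_le hba
      obtain ⟨f, rfl⟩ := Nat.exists_eq_add_of_le hdb
      obtain ⟨d, rfl⟩ := Nat.exists_eq_add_of_le' hd
      nlinarith [Nat.zero_le (e * d), Nat.zero_le (e * f), Nat.zero_le (f * f),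
        Nat.zero_le (f * d)]
  rw [pairValue_of_pos (by omega) hc, hab]
  rcases Nat.eq_zero_or_pos d with rfl | hd
  · rw [pairValue_zero_right, pairValue_zero_right]
    obtain ⟨e, rfl⟩ := Nat.exists_eq_add_of_le hba
    obtain ⟨f, rfl⟩ := Nat.exists_eq_add_of_le hcb
    obtain ⟨c, rfl⟩ := Nat.exists_eq_add_of_le' hc
    rcases Nat.eq_zero_or_pos f with rfl | hf
    · nlinarith
    · nlinarith [Nat.zero_le (e * c), Nat.zero_le (e * f), Nat.zero_le (f * c),
        Nat.mul_le_mul hf hf]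
  rw [pairValue_of_pos hb hd, pairValue_of_pos hc hd]
  obtain ⟨e, rfl⟩ := Nat.exists_eq_add_of_le hba
  obtain ⟨f, rfl⟩ := Nat.exists_eq_add_of_le hcb
  obtain ⟨g, hg⟩ := Nat.exists_eq_add_of_le hdb
  nlinarith [Nat.zero_le (e * f), Nat.zero_le (f * g)]

lemma pairValue_contract_same {e f u w : ℕ} (hu : 1 ≤ u) (hw : 1 ≤ w) :
    pairValue (e + 1) f + u * w ≤ pairValue (e + u) (f + w) := by
  rw [pairValue_of_pos (a := e + u) (by omega) (by omega)]
  obtain ⟨u, rfl⟩ := Nat.exists_eq_add_of_le' hu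
  obtain ⟨w, rfl⟩ := Nat.exists_eq_add_of_le' hw
  rcases Nat.eq_zero_or_pos f with rfl | hf
  · rw [pairValue_zero_right]; nlinarith
  · rw [pairValue_of_pos (by omega) hf]; nlinarith

lemma pairValue_add_left {a b : ℕ} (u : ℕ) (ha : 1 ≤ a) :
    pairValue (a + u) b = pairValue a b + u * max b 1 := by
  rcases Nat.eq_zero_or_pos b with rfl | hb
  · simp [pairValue_zero_right]
  · rw [pairValue_of_pos (by omega) hb, pairValue_of_pos ha hb, max_eq_left hb]; ring

lemma pairValue_add_le_add_left (a b u : ℕ) : pairValue a b + u ≤ pairValue (a + u) b := by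
  induction u with
  | zero => rfl
  | succ u ih => have := pairValue_succ_left (a + u) b; rw [← add_assoc, ← add_assoc]; omega

lemma pairValue_contract {e f u w : ℕ} (c d : ℕ) (hu : 1 ≤ u) (hw : 1 ≤ w) :
    pairValue (e + 1) c + pairValue f d + u * w ≤ pairValue (e + u) c + pairValue (f + w) d ∨
    pairValue (e + 1) c + pairValue f d + u * w ≤ pairValue (e + u) (f + w) + pairValue c d := by
  obtain ⟨u, rfl⟩ := Nat.exists_eq_add_of_le' hu
  have h1 : pairValue (e + (u + 1)) c = pairValue (e + 1) c + u * max c 1 := by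
    rw [← pairValue_add_left u (by omega)]; congr 1; ring
  have h2 := pairValue_add_le_add_left f d w
  by_cases hcw : w ≤ max c 1
  · left
    nlinarith [Nat.mul_le_mul_left u hcw]
  by_cases hdu : f ≠ 0 ∧ u + 1 ≤ max d 1
  · left
    rw [pairValue_add_left w (by omega)]
    nlinarith [Nat.mul_le_mul_left w hdu.2, Nat.zero_le (u * max c 1)]
  right
  have hc : c < w := by omega
  have h3 := add_le_pairValue c d
  rw [pairValue_of_pos (a := e + (u + 1)) (by omega) (by omega)]
  have h4 : pairValue (e + 1) c ≤ (e + 1) * c + 1 + e := by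
    rcases Nat.eq_zero_or_pos c with rfl | hc
    · rw [pairValue_zero_right]; omega
    · rw [pairValue_of_pos (by omega) hc]; omega
  have h5 : pairValue (e + 1) c ≤ e * w + c + 1 := by
    rcases Nat.eq_zero_or_pos c with rfl | hc'
    · rw [pairValue_zero_right]; nlinarith
    · rw [pairValue_of_pos (by omega) hc']; nlinarith
  have h6 : pairValue f d ≤ f * (u + 1) + d := by
    rcases Nat.eq_zero_or_pos f with rfl | hf
    · rw [pairValue_zero_left]; omega
    rcases Nat.eq_zero_or_pos d with rfl | hd
    · rw [pairValue_zero_right]; nlinarith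
    · have : d ≤ u := by omega
      rw [pairValue_of_pos hf hd]; nlinarith
  nlinarith [Nat.zero_le (e * f)]

/-- `σ` restricts to a fixed-point-free involution of `s`, i.e. to a perfect matching of `s`. -/
def IsPairing (s : Finset ℕ) (σ : ℕ → ℕ) : Prop :=
  ∀ i ∈ s, σ i ∈ s ∧ σ i ≠ i ∧ σ (σ i) = i

/-- Twice the total value of the pairs of the matching `σ`, for parts of sizes `n i`. -/
def pairingWeight (s : Finset ℕ) (σ n : ℕ → ℕ) : ℕ := ∑ i ∈ s, pairValue (n i) (n (σ i))

namespace IsPairing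

variable {s : Finset ℕ} {σ : ℕ → ℕ}

lemma weight_eq (h : IsPairing s σ) (n : ℕ → ℕ) {a : ℕ} (ha : a ∈ s) :
    pairingWeight s σ n = 2 * pairValue (n a) (n (σ a)) +
      ∑ i ∈ s \ {a, σ a}, pairValue (n i) (n (σ i)) := by
  obtain ⟨h1, h2, h3⟩ := h a ha
  have hsub : ({a, σ a} : Finset ℕ) ⊆ s := by
    intro i; simp only [mem_insert, mem_singleton]; rintro (rfl | rfl) <;> assumption
  rw [pairingWeight, ← sum_sdiff hsub, sum_pair h2.symm, h3, pairValue_comm (n (σ a))]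
  ring

lemma weight_eq_of_ne (h : IsPairing s σ) (n : ℕ → ℕ) {a b : ℕ} (ha : a ∈ s) (hb : b ∈ s)
    (hba : b ≠ a) (hab : σ a ≠ b) :
    pairingWeight s σ n = 2 * pairValue (n a) (n (σ a)) + 2 * pairValue (n b) (n (σ b)) +
      ∑ i ∈ s \ {a, σ a, b, σ b}, pairValue (n i) (n (σ i)) := by
  obtain ⟨h1, h2, h3⟩ := h a ha
  obtain ⟨h4, h5, h6⟩ := h b hb
  have h7 : σ b ≠ a := by rintro rfl; exact hab h6
  have h8 : σ b ≠ σ a := by intro e; rw [e, h3] at h6; exact hba h6.symm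
  have hsub : ({b, σ b} : Finset ℕ) ⊆ s \ {a, σ a} := by
    intro i; simp only [mem_insert, mem_singleton, mem_sdiff]
    rintro (rfl | rfl)
    · exact ⟨hb, by rintro (e | e); exacts [hba e, hab e.symm]⟩
    · exact ⟨h4, by rintro (e | e); exacts [h7 e, h8 e]⟩
  have hset : (s \ {a, σ a}) \ {b, σ b} = s \ {a, σ a, b, σ b} := by
    ext i; simp only [mem_insert, mem_singleton, mem_sdiff]; tauto
  rw [h.weight_eq n ha, ← sum_sdiff hsub, sum_pair h5.symm, h6, pairValue_comm (n (σ b)), hset]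
  ring

lemma exists_exchange (h : IsPairing s σ) {a b : ℕ} (ha : a ∈ s) (hb : b ∈ s)
    (hba : b ≠ a) (hab : σ a ≠ b) :
    ∃ τ, IsPairing s τ ∧ τ a = b ∧ (∀ i, i ≠ a → i ≠ b → i ≠ σ a → i ≠ σ b → τ i = σ i) ∧
      ∀ n : ℕ → ℕ, pairingWeight s τ n + 2 * pairValue (n a) (n (σ a)) +
          2 * pairValue (n b) (n (σ b)) =
        pairingWeight s σ n + 2 * pairValue (n a) (n b) + 2 * pairValue (n (σ a)) (n (σ b)) := by
  obtain ⟨h1, h2, h3⟩ := h a ha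
  obtain ⟨h4, h5, h6⟩ := h b hb
  have h7 : σ b ≠ a := by rintro rfl; exact hab h6
  have h8 : σ b ≠ σ a := by intro e; rw [e, h3] at h6; exact hba h6.symm
  let τ : ℕ → ℕ := fun i =>
    if i = a then b else if i = b then a else if i = σ a then σ b else if i = σ b then σ a else σ i
  have ta : τ a = b := by simp [τ]
  have tb : τ b = a := by simp [τ, hba]
  have tc : τ (σ a) = σ b := by simp [τ, h2, hab]
  have td : τ (σ b) = σ a := by simp [τ, h7, h5, h8]
  have tne : ∀ i, i ≠ a → i ≠ b → i ≠ σ a → i ≠ σ b → τ i = σ i := by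
    intro i i1 i2 i3 i4; simp [τ, i1, i2, i3, i4]
  have hτ : IsPairing s τ := by
    intro i hi
    by_cases i1 : i = a
    · subst i1; rw [ta]; exact ⟨hb, hba, tb⟩
    by_cases i2 : i = b
    · subst i2; rw [tb]; exact ⟨ha, hba.symm, ta⟩
    by_cases i3 : i = σ a
    · subst i3; rw [tc]; exact ⟨h4, h8, td⟩
    by_cases i4 : i = σ b
    · subst i4; rw [td]; exact ⟨h1, h8.symm, tc⟩
    obtain ⟨g1, g2, g3⟩ := h i hi
    rw [tne i i1 i2 i3 i4]
    refine ⟨g1, g2, ?_⟩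
    rw [tne, g3]
    · rintro e; rw [e] at g3; exact i3 g3.symm
    · rintro e; rw [e] at g3; exact i4 g3.symm
    · rintro e; rw [e, h3] at g3; exact i1 g3.symm
    · rintro e; rw [e, h6] at g3; exact i2 g3.symm
  refine ⟨τ, hτ, ta, tne, fun n => ?_⟩
  have hne : τ a ≠ σ a := by rw [ta]; exact hab.symm
  have hset : s \ {a, τ a, σ a, τ (σ a)} = s \ {a, σ a, b, σ b} := by
    rw [ta, tc]; ext i; simp only [mem_insert, mem_singleton, mem_sdiff]; tauto
  rw [hτ.weight_eq_of_ne n ha h1 h2 hne, h.weight_eq_of_ne n ha hb hba hab, hset, ta, tc]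
  have : ∑ i ∈ s \ {a, σ a, b, σ b}, pairValue (n i) (n (τ i)) =
      ∑ i ∈ s \ {a, σ a, b, σ b}, pairValue (n i) (n (σ i)) := by
    refine sum_congr rfl fun i hi => ?_
    simp only [mem_insert, mem_singleton, mem_sdiff, not_or] at hi
    rw [tne i hi.2.1 hi.2.2.2.1 hi.2.2.1 hi.2.2.2.2]
  rw [this]; ring

lemma weight_succ_le (h : IsPairing s σ) {n n' : ℕ → ℕ} {a : ℕ} (ha : a ∈ s)
    (hn : n a = n' a + 1) (hn' : ∀ i, i ≠ a → n i = n' i) :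
    pairingWeight s σ n' + 2 ≤ pairingWeight s σ n := by
  have h2 := (h a ha).2.1
  rw [h.weight_eq n ha, h.weight_eq n' ha, hn, hn' _ h2]
  have := pairValue_succ_left (n' a) (n' (σ a))
  have : ∑ i ∈ s \ {a, σ a}, pairValue (n i) (n (σ i)) =
      ∑ i ∈ s \ {a, σ a}, pairValue (n' i) (n' (σ i)) := by
    refine sum_congr rfl fun i hi => ?_
    simp only [mem_insert, mem_singleton, mem_sdiff, not_or] at hi
    rw [hn' i hi.2.1, hn' (σ i)]
    rintro rfl
    exact hi.2.2 (h i hi.1).2.2.symm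
  omega

lemma exists_weight_contract (h : IsPairing s σ) {n n' : ℕ → ℕ} {a b u w : ℕ} (ha : a ∈ s)
    (hb : b ∈ s) (hba : b ≠ a) (hu : 1 ≤ u) (hw : 1 ≤ w) (hna : n a + 1 = n' a + u)
    (hna' : 1 ≤ n' a) (hnb : n b = n' b + w) (hn : ∀ i, i ≠ a → i ≠ b → n i = n' i) :
    ∃ τ, IsPairing s τ ∧ pairingWeight s σ n' + 2 * (u * w) ≤ pairingWeight s τ n := by
  obtain ⟨e, he⟩ := Nat.exists_eq_add_of_le' hna'
  have hna : n a = e + u := by omega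
  by_cases hab : σ a = b
  · refine ⟨σ, h, ?_⟩
    have : ∑ i ∈ s \ {a, σ a}, pairValue (n i) (n (σ i)) =
        ∑ i ∈ s \ {a, σ a}, pairValue (n' i) (n' (σ i)) := by
      refine sum_congr rfl fun i hi => ?_
      simp only [mem_insert, mem_singleton, mem_sdiff, not_or] at hi
      have h3 := (h i hi.1).2.2
      rw [hn i hi.2.1 (hab ▸ hi.2.2), hn (σ i)]
      · rintro rfl; exact hi.2.2 h3.symm
      · intro e
        rw [e, ← hab, (h a ha).2.2] at h3
        exact hi.2.1 h3.symm
    rw [h.weight_eq n ha, h.weight_eq n' ha, this, hab, hna, hnb, he]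
    have := pairValue_contract_same (e := e) (f := n' b) hu hw
    omega
  · obtain ⟨τ, hτ, -, -, hτw⟩ := h.exists_exchange ha hb hba hab
    obtain ⟨h1, h2, h3⟩ := h a ha
    obtain ⟨h4, h5, h6⟩ := h b hb
    have h7 : σ b ≠ a := by rintro rfl; exact hab h6
    have hrest : ∑ i ∈ s \ {a, σ a, b, σ b}, pairValue (n i) (n (σ i)) =
        ∑ i ∈ s \ {a, σ a, b, σ b}, pairValue (n' i) (n' (σ i)) := by
      refine sum_congr rfl fun i hi => ?_
      simp only [mem_insert, mem_singleton, mem_sdiff, not_or] at hi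
      obtain ⟨hi, i1, i2, i3, i4⟩ := hi
      have g3 := (h i hi).2.2
      rw [hn i i1 i3, hn (σ i)]
      · rintro rfl; exact i2 g3.symm
      · rintro rfl; exact i4 g3.symm
    have e1 := h.weight_eq_of_ne n ha hb hba hab
    have e2 := h.weight_eq_of_ne n' ha hb hba hab
    have e3 := hτw n
    rw [hna, hnb, hn _ h2 hab, hn _ h7 h5] at e1 e3
    rw [he] at e2
    rcases pairValue_contract (e := e) (f := n' b) (n' (σ a)) (n' (σ b)) hu hw with hc | hc
    · exact ⟨σ, h, by omega⟩
    · exact ⟨τ, hτ, by omega⟩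

lemma exists_consecutive {N : ℕ} (h : IsPairing (range (2 * N)) σ) {n : ℕ → ℕ} (hn : Antitone n)
    {j : ℕ} (hj : j ≤ N) :
    ∃ τ, IsPairing (range (2 * N)) τ ∧
      pairingWeight (range (2 * N)) σ n ≤ pairingWeight (range (2 * N)) τ n ∧
      ∀ i < j, τ (2 * i) = 2 * i + 1 := by
  induction j with
  | zero => exact ⟨σ, h, le_rfl, by simp⟩
  | succ j ih =>
    obtain ⟨τ, hτ, hw, hc⟩ := ih (by omega)
    by_cases hab : τ (2 * j) = 2 * j + 1
    · refine ⟨τ, hτ, hw, fun i hi => ?_⟩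
      rcases Nat.lt_succ_iff_lt_or_eq.mp hi with hi | rfl
      exacts [hc i hi, hab]
    have ha : 2 * j ∈ range (2 * N) := by simp; omega
    have hb : 2 * j + 1 ∈ range (2 * N) := by simp; omega
    have hlow : ∀ k ∈ range (2 * N), 2 * j ≤ k → 2 * j ≤ τ k := by
      intro k hk hjk
      by_contra hlt
      obtain ⟨h1, h2, h3⟩ := hτ k hk
      rcases Nat.even_or_odd' (τ k) with ⟨i, hi | hi⟩
      · have := hc i (by omega)
        rw [← hi, h3] at this; omega
      · have h4 := hc i (by omega)
        have h5 := (hτ (2 * i) (by simp; omega)).2.2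
        rw [h4, ← hi, h3] at h5; omega
    have hca := hlow _ ha le_rfl
    have hcb := hlow _ hb (by omega)
    obtain ⟨h1, h2, h3⟩ := hτ _ ha
    obtain ⟨h4, h5, h6⟩ := hτ _ hb
    have h7 : τ (2 * j + 1) ≠ 2 * j := by intro e; rw [e] at h6; exact hab h6
    obtain ⟨ρ, hρ, hρa, hρne, hρw⟩ := hτ.exists_exchange ha hb (by omega) hab
    refine ⟨ρ, hρ, ?_, fun i hi => ?_⟩
    · have := hρw n
      have := pairValue_exchange (hn (show 2 * j ≤ 2 * j + 1 by omega))
        (hn (show 2 * j + 1 ≤ τ (2 * j) by omega))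
        (hn (show 2 * j + 1 ≤ τ (2 * j + 1) by omega))
      omega
    · rcases Nat.lt_succ_iff_lt_or_eq.mp hi with hi | rfl
      · rw [hρne _ (by omega) (by omega) (by omega) (by omega), hc i hi]
      · exact hρa

lemma weight_le {N : ℕ} (h : IsPairing (range (2 * N)) σ) {n : ℕ → ℕ} (hn : Antitone n) :
    pairingWeight (range (2 * N)) σ n ≤
      2 * ∑ i ∈ range N, pairValue (n (2 * i)) (n (2 * i + 1)) := by
  obtain ⟨τ, hτ, hw, hc⟩ := h.exists_consecutive hn le_rfl
  refine hw.trans (le_of_eq ?_)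
  have hsum : ∀ M ≤ N, pairingWeight (range (2 * M)) τ n =
      2 * ∑ i ∈ range M, pairValue (n (2 * i)) (n (2 * i + 1)) := by
    intro M hM
    induction M with
    | zero => simp [pairingWeight]
    | succ M ih =>
      have h1 := hc M (by omega)
      have h2 := (hτ (2 * M) (by simp; omega)).2.2
      rw [h1] at h2
      have := ih (by omega)
      rw [pairingWeight] at this ⊢
      rw [show 2 * (M + 1) = 2 * M + 1 + 1 by ring, sum_range_succ, sum_range_succ, this, h1, h2,
        sum_range_succ, pairValue_comm (n (2 * M + 1))]
      ring
  exact hsum N le_rfl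

end IsPairing

lemma exists_isPairing_range (N : ℕ) : ∃ σ, IsPairing (range (2 * N)) σ := by
  refine ⟨fun i => if i % 2 = 0 then i + 1 else i - 1, fun i hi => ?_⟩
  simp only [mem_range] at hi ⊢
  refine ⟨?_, ?_, ?_⟩ <;> split_ifs <;> omega

section Coloring

variable {V α : Type*}

/-- The colors that occur on the edges inside `W` of the complete multipartite graph with parts
the fibers of `p`. -/
def edgeColors [DecidableEq α] (p : V → ℕ) (c : V → V → α) (W : Finset V) : Finset α :=
  ((W ×ˢ W).filter fun x => p x.1 ≠ p x.2).image fun x => c x.1 x.2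

/-- The number of vertices of `W` in the part `i`. -/
def partSize (p : V → ℕ) (W : Finset V) (i : ℕ) : ℕ := #{v ∈ W | p v = i}

variable {p : V → ℕ} {c : V → V → α} {W : Finset V}

lemma mem_edgeColors [DecidableEq α] {γ : α} :
    γ ∈ edgeColors p c W ↔ ∃ v ∈ W, ∃ x ∈ W, p v ≠ p x ∧ c v x = γ := by
  simp only [edgeColors, mem_image, mem_filter, mem_product, Prod.exists]
  constructor
  · rintro ⟨v, x, ⟨⟨hv, hx⟩, h⟩, rfl⟩; exact ⟨v, hv, x, hx, h, rfl⟩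
  · rintro ⟨v, hv, x, hx, h, rfl⟩; exact ⟨v, x, ⟨⟨hv, hx⟩, h⟩, rfl⟩

lemma partSize_pos {W : Finset V} {v : V} (hv : v ∈ W) : 1 ≤ partSize p W (p v) :=
  card_pos.mpr ⟨v, by simp [hv]⟩

lemma partSize_erase_self [DecidableEq V] {v : V} (hv : v ∈ W) :
    partSize p W (p v) = partSize p (W.erase v) (p v) + 1 := by
  unfold partSize
  rw [filter_erase, card_erase_add_one (by simp [hv])]

lemma partSize_erase_of_ne [DecidableEq V] {v : V} {i : ℕ} (hi : i ≠ p v) :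
    partSize p W i = partSize p (W.erase v) i := by
  unfold partSize
  rw [filter_erase, erase_eq_of_notMem (by simp [hi.symm])]

lemma card_edgeColors_le_erase [DecidableEq V] [DecidableEq α]
    (hsymm : ∀ x y, c x y = c y x)
    (hrain : ∀ x y z, p x ≠ p y → p y ≠ p z → p x ≠ p z →
      c x y = c y z ∨ c y z = c x z ∨ c x y = c x z) {v : V} (hv : v ∈ W)
    (hsep : ∀ x ∈ W, p v ≠ p x → ∃ z ∈ W, p z ≠ p v ∧ p z ≠ p x ∧ c x z ≠ c v z) :
    #(edgeColors p c W) ≤ #(edgeColors p c (W.erase v)) + 1 := by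
  have hmem : ∀ {x y}, x ∈ W → y ∈ W → p x ≠ p v → p y ≠ p v → p x ≠ p y →
      c x y ∈ edgeColors p c (W.erase v) := fun {x y} hx hy hxv hyv hxy =>
    mem_edgeColors.mpr ⟨x, mem_erase.mpr ⟨by rintro rfl; exact hxv rfl, hx⟩, y,
      mem_erase.mpr ⟨by rintro rfl; exact hyv rfl, hy⟩, hxy, rfl⟩
  have hform : ∀ γ ∈ edgeColors p c W \ edgeColors p c (W.erase v),
      ∃ x ∈ W, p v ≠ p x ∧ c v x = γ := by
    intro γ hγ
    obtain ⟨hγ, hγ'⟩ := mem_sdiff.mp hγ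
    obtain ⟨y, hy, x, hx, hyx, rfl⟩ := mem_edgeColors.mp hγ
    by_cases h1 : y = v
    · subst h1; exact ⟨x, hx, hyx, rfl⟩
    by_cases h2 : x = v
    · subst h2; exact ⟨y, hy, hyx.symm, hsymm _ _⟩
    exact absurd (mem_edgeColors.mpr
      ⟨y, mem_erase.mpr ⟨h1, hy⟩, x, mem_erase.mpr ⟨h2, hx⟩, hyx, rfl⟩) hγ'
  have hagree : ∀ {x y}, x ∈ W → y ∈ W → p v ≠ p x → p v ≠ p y → p x ≠ p y →
      c v x ∉ edgeColors p c (W.erase v) → c v y ∉ edgeColors p c (W.erase v) →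
      c v x = c v y := by
    intro x y hx hy hvx hvy hxy h1 h2
    have h3 := hmem hx hy hvx.symm hvy.symm hxy
    rcases hrain v x y hvx hxy hvy with h | h | h
    · rw [h] at h1; exact absurd h3 h1
    · rw [← h] at h2; exact absurd h3 h2
    · exact h
  have hone : #(edgeColors p c W \ edgeColors p c (W.erase v)) ≤ 1 := by
    refine card_le_one.mpr fun γ hγ δ hδ => ?_
    obtain ⟨x, hx, hvx, rfl⟩ := hform γ hγ
    obtain ⟨y, hy, hvy, rfl⟩ := hform δ hδ
    replace hγ := (mem_sdiff.mp hγ).2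
    replace hδ := (mem_sdiff.mp hδ).2
    by_cases hxy : p x = p y
    · obtain ⟨z, hz, hzv, hzx, hne⟩ := hsep x hx hvx
      have h3 := hmem hx hz hvx.symm hzv hzx.symm
      have hvz : c v x = c v z := by
        rcases hrain v x z hvx hzx.symm hzv.symm with h | h | h
        · rw [h] at hγ; exact absurd h3 hγ
        · exact absurd h hne
        · exact h
      rw [hvz] at hγ ⊢
      exact hagree hz hy hzv.symm hvy (hxy ▸ hzx) hγ hδ
    · exact hagree hx hy hvx hvy hxy hγ hδ
  calc #(edgeColors p c W)
      ≤ #(edgeColors p c (W.erase v) ∪ (edgeColors p c W \ edgeColors p c (W.erase v))) :=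
        card_le_card (by intro γ hγ; simp [hγ])
    _ ≤ _ := (card_union_le _ _).trans (by omega)

/-- The vertices of `W` in the parts of `v` and `x` that see all the other parts as `v` does. -/
def twins [DecidableEq α] (p : V → ℕ) (c : V → V → α) (W : Finset V) (v x : V) : Finset V :=
  {y ∈ W | (p y = p v ∨ p y = p x) ∧ ∀ z ∈ W, p z ≠ p v → p z ≠ p x → c y z = c v z}

lemma edgeColors_subset_contract [DecidableEq V] [DecidableEq α]
    (hsymm : ∀ x y, c x y = c y x)
    (hrain : ∀ x y z, p x ≠ p y → p y ≠ p z → p x ≠ p z →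
      c x y = c y z ∨ c y z = c x z ∨ c x y = c x z) {v x : V} (hv : v ∈ W) :
    edgeColors p c W ⊆ edgeColors p c (W \ (twins p c W v x).erase v) ∪
      (({y ∈ twins p c W v x | p y = p v} ×ˢ {y ∈ twins p c W v x | p y = p x}).image
        fun e => c e.1 e.2) := by
  set M := twins p c W v x with hM
  have hMmem : ∀ y, y ∈ M ↔ y ∈ W ∧ (p y = p v ∨ p y = p x) ∧
      ∀ z ∈ W, p z ≠ p v → p z ≠ p x → c y z = c v z := by
    intro y; simp [hM, twins]
  have hvM : v ∈ M := (hMmem v).mpr ⟨hv, Or.inl rfl, fun _ _ _ _ => rfl⟩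
  have hkeep : ∀ {y z}, y ∈ W → z ∈ W → (y ∉ M ∨ y = v) → (z ∉ M ∨ z = v) → p y ≠ p z →
      c y z ∈ edgeColors p c (W \ M.erase v) := by
    intro y z hy hz hy' hz' hyz
    refine mem_edgeColors.mpr ⟨y, ?_, z, ?_, hyz, rfl⟩ <;>
      simp only [mem_sdiff, mem_erase, not_and] <;> tauto
  have hcross : ∀ {y z}, y ∈ M → z ∈ W → z ∉ M → p y ≠ p z →
      c y z ∈ edgeColors p c (W \ M.erase v) := by
    intro y z hy hz hzM hyz
    obtain ⟨hyW, hyp, hyc⟩ := (hMmem y).mp hy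
    by_cases hzp : p z = p v ∨ p z = p x
    · have : ∃ t ∈ W, p t ≠ p v ∧ p t ≠ p x ∧ c z t ≠ c v t := by
        by_contra hcon
        push Not at hcon
        exact hzM ((hMmem z).mpr ⟨hz, hzp, hcon⟩)
      obtain ⟨t, ht, htv, htx, hne⟩ := this
      have htM : t ∉ M := by
        intro h
        rcases ((hMmem t).mp h).2.1 with h | h
        exacts [htv h, htx h]
      have htz : p z ≠ p t := by rcases hzp with h | h <;> rw [h] <;> [exact htv.symm; exact htx.symm]
      have hty : p y ≠ p t := by rcases hyp with h | h <;> rw [h] <;> [exact htv.symm; exact htx.symm]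
      have hyt := hyc t ht htv htx
      rcases hrain y z t hyz htz hty with h | h | h
      · rw [h]; exact hkeep hz ht (Or.inl hzM) (Or.inl htM) htz
      · exact absurd (h.trans hyt) hne
      · rw [h, hyt]; exact hkeep hv ht (Or.inr rfl) (Or.inl htM) htv.symm
    · push Not at hzp
      rw [hyc z hz hzp.1 hzp.2]
      exact hkeep hv hz (Or.inr rfl) (Or.inl hzM) hzp.1.symm
  intro γ hγ
  obtain ⟨y, hy, z, hz, hyz, rfl⟩ := mem_edgeColors.mp hγ
  rw [mem_union]
  by_cases hyM : y ∈ M <;> by_cases hzM : z ∈ M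
  · right
    have h1 := ((hMmem y).mp hyM).2.1
    have h2 := ((hMmem z).mp hzM).2.1
    rw [mem_image]
    by_cases h3 : p y = p v
    · refine ⟨(y, z), ?_, rfl⟩
      have : p z = p x := h2.resolve_left fun h => hyz (h3.trans h.symm)
      simp [hyM, hzM, h3, this]
    · have h4 := h1.resolve_left h3
      have h5 : p z = p v := h2.resolve_right fun h => hyz (h4.trans h.symm)
      exact ⟨(z, y), by simp [hyM, hzM, h4, h5], hsymm _ _⟩
  · exact Or.inl (hcross hyM hz hzM hyz)
  · left; rw [hsymm]; exact hcross hzM hy hyM hyz.symm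
  · exact Or.inl (hkeep hy hz (Or.inl hyM) (Or.inl hzM) hyz)

lemma partSize_sdiff [DecidableEq V] {T : Finset V} (hT : T ⊆ W) (i : ℕ) :
    partSize p W i = partSize p (W \ T) i + partSize p T i := by
  unfold partSize
  rw [← card_union_of_disjoint, ← filter_union, sdiff_union_of_subset hT]
  exact disjoint_filter_filter sdiff_disjoint

theorem exists_pairing_card_edgeColors_le [DecidableEq V] [DecidableEq α] {s : Finset ℕ}
    (hs : ∃ σ, IsPairing s σ)
    (hsymm : ∀ x y, c x y = c y x)
    (hrain : ∀ x y z, p x ≠ p y → p y ≠ p z → p x ≠ p z →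
      c x y = c y z ∨ c y z = c x z ∨ c x y = c x z)
    (W : Finset V) (hW : W.Nonempty) (hp : ∀ v ∈ W, p v ∈ s) :
    ∃ σ, IsPairing s σ ∧
      2 * (#(edgeColors p c W) + 1) ≤ pairingWeight s σ (partSize p W) := by
  induction W using Finset.strongInduction with
  | H W ih =>
  by_cases hmod : ∃ v ∈ W, ∃ x ∈ W, p v ≠ p x ∧
      ∀ z ∈ W, p z ≠ p v → p z ≠ p x → c x z = c v z
  · obtain ⟨v, hv, x, hx, hvx, htwin⟩ := hmod
    set M := twins p c W v x with hM
    have hvM : v ∈ M := by simp [hM, twins, hv]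
    have hxM : x ∈ M := by simpa [hM, twins, hx] using htwin
    have hMW : M ⊆ W := filter_subset _ _
    have hMp : ∀ y ∈ M, p y = p v ∨ p y = p x := fun y hy => (mem_filter.mp hy).2.1
    have hTW : M.erase v ⊆ W := (erase_subset _ _).trans hMW
    have hxv : x ≠ v := by rintro rfl; exact hvx rfl
    have hvW' : v ∈ W \ M.erase v := by simp [hv]
    obtain ⟨σ, hσ, hle⟩ := ih (W \ M.erase v)
      (sdiff_ssubset hTW ⟨x, mem_erase.mpr ⟨hxv, hxM⟩⟩) ⟨v, hvW'⟩
      fun y hy => hp y (mem_sdiff.mp hy).1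
    obtain ⟨τ, hτ, hle'⟩ := hσ.exists_weight_contract (n := partSize p W)
      (n' := partSize p (W \ M.erase v)) (u := partSize p M (p v)) (w := partSize p M (p x))
      (hp v hv) (hp x hx) hvx.symm (partSize_pos hvM) (partSize_pos hxM)
      (by rw [partSize_sdiff hTW, partSize_erase_self hvM]; ring)
      (partSize_pos hvW')
      (by rw [partSize_sdiff hTW, partSize_erase_of_ne (W := M) hvx.symm])
      (by
        intro i hiv hix
        rw [partSize_sdiff hTW, ← partSize_erase_of_ne (W := M) hiv]
        simp only [Nat.add_eq_left, partSize, card_eq_zero, filter_eq_empty_iff]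
        rintro y hy rfl
        rcases hMp y hy with h | h
        exacts [hiv h, hix h])
    refine ⟨τ, hτ, le_trans ?_ hle'⟩
    have hcard := (card_le_card (edgeColors_subset_contract hsymm hrain (x := x) hv)).trans
      ((card_union_le _ _).trans (Nat.add_le_add_left card_image_le _))
    rw [card_product, ← hM] at hcard
    change _ ≤ _ + partSize p M (p v) * partSize p M (p x) at hcard
    omega
  · push Not at hmod
    obtain ⟨v, hv⟩ := hW
    have hcard := card_edgeColors_le_erase hsymm hrain hv (hmod v hv)
    rcases (W.erase v).eq_empty_or_nonempty with hemp | hne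
    · obtain ⟨σ, hσ⟩ := hs
      refine ⟨σ, hσ, ?_⟩
      have h0 : edgeColors p c W = ∅ := by
        refine eq_empty_of_forall_notMem fun γ hγ => ?_
        obtain ⟨y, hy, z, hz, hyz, -⟩ := mem_edgeColors.mp hγ
        have hall : ∀ t ∈ W, t = v := fun t ht => by
          by_contra h
          exact notMem_empty t (hemp ▸ mem_erase.mpr ⟨h, ht⟩)
        rw [hall y hy, hall z hz] at hyz
        exact hyz rfl
      have h1 := hσ.weight_succ_le (n := partSize p W) (hp v hv) (partSize_erase_self hv)
        fun i hi => partSize_erase_of_ne hi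
      rw [h0, card_empty]
      omega
    · obtain ⟨σ, hσ, hle⟩ := ih _ (erase_ssubset hv) hne fun y hy => hp y (mem_of_mem_erase hy)
      have h1 := hσ.weight_succ_le (n := partSize p W) (hp v hv) (partSize_erase_self hv)
        fun i hi => partSize_erase_of_ne hi
      exact ⟨σ, hσ, by omega⟩

end Coloring

lemma exists_surjOnEdges_of_card_le {V α : Type*} [DecidableEq α] {G : SimpleGraph V}
    {c : Sym2 V → α} {k : ℕ} (hk : 0 < k) (hc : ¬ RainbowC3 G c) (S : Finset α) (hS : k ≤ #S)
    (hsurj : ∀ γ ∈ S, ∃ e ∈ G.edgeSet, c e = γ) :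
    ∃ c' : Sym2 V → Fin k, SurjOnEdges G c' ∧ ¬ RainbowC3 G c' := by
  obtain ⟨T, hTS, hT⟩ := exists_subset_card_eq hS
  let f : T ≃ Fin k := T.equivFinOfCardEq hT
  let g : α → Fin k := fun γ => if h : γ ∈ T then f ⟨γ, h⟩ else ⟨0, hk⟩
  refine ⟨fun e => g (c e), fun i => ?_, ?_⟩
  · obtain ⟨e, he, hei⟩ := hsurj (f.symm i) (hTS (f.symm i).2)
    refine ⟨e, he, ?_⟩
    simp [g, hei]
  · rintro ⟨x, y, z, h1, h2, h3, h4, h5, h6⟩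
    exact hc ⟨x, y, z, h1, h2, h3, fun h => h4 (congrArg g h), fun h => h5 (congrArg g h),
      fun h => h6 (congrArg g h)⟩

/-- The color of the edge between the `x`-th vertex of part `i` and the `y`-th vertex of part `j`,
where `i < j`, in the extremal coloring: parts are grouped into consecutive pairs, the edges inside
a pair are rainbow, and other edges are colored by the later pair, or by the later vertex if it lies
in an unpaired last part. -/
def extremalColorOfLt (r i x j y : ℕ) : ℕ × ℕ × ℕ :=
  if i / 2 = j / 2 then (j / 2, x + 1, y) else (j / 2, 0, if j + 1 = r ∧ Odd r then y else 0)

/-- The extremal coloring of the pairs of vertices `(i, x)`, where `i` is the part. -/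
def extremalColor (r : ℕ) (v w : ℕ × ℕ) : ℕ × ℕ × ℕ :=
  if v.1 < w.1 then extremalColorOfLt r v.1 v.2 w.1 w.2
  else if w.1 < v.1 then extremalColorOfLt r w.1 w.2 v.1 v.2 else 0

lemma extremalColor_comm (r : ℕ) (v w : ℕ × ℕ) : extremalColor r v w = extremalColor r w v := by
  unfold extremalColor
  rcases lt_trichotomy v.1 w.1 with h | h | h
  · simp [h, h.not_gt]
  · simp [h]
  · simp [h, h.not_gt]

lemma extremalColor_eq_of_lt_of_lt {r : ℕ} {u v w : ℕ × ℕ} (huv : u.1 < v.1) (hvw : v.1 < w.1)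
    (hw : w.1 < r) :
    extremalColor r u w = extremalColor r v w ∨ extremalColor r u v = extremalColor r u w := by
  have huw := huv.trans hvw
  simp only [extremalColor, huv, hvw, huw, if_true, extremalColorOfLt]
  have h1 : ¬ u.1 / 2 = w.1 / 2 := by omega
  by_cases h2 : v.1 / 2 = w.1 / 2
  · right
    have h3 : ¬ u.1 / 2 = v.1 / 2 := by omega
    have h4 : ¬ (v.1 + 1 = r ∧ Odd r) := by omega
    have h5 : ¬ (w.1 + 1 = r ∧ Odd r) := by
      rintro ⟨h, k, hk⟩; omega
    rw [if_neg h3, if_neg h1, if_neg h4, if_neg h5, h2]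
  · left
    rw [if_neg h1, if_neg h2]

lemma extremalColor_not_rainbow {r : ℕ} {u v w : ℕ × ℕ} (hu : u.1 < r) (hv : v.1 < r)
    (hw : w.1 < r) (huv : u.1 ≠ v.1) (hvw : v.1 ≠ w.1) (hwu : w.1 ≠ u.1) :
    extremalColor r u v = extremalColor r v w ∨ extremalColor r v w = extremalColor r w u ∨
      extremalColor r u v = extremalColor r w u := by
  have e1 := extremalColor_comm r u v
  have e2 := extremalColor_comm r v w
  have e3 := extremalColor_comm r w u
  rcases huv.lt_or_gt with h1 | h1 <;> rcases hvw.lt_or_gt with h2 | h2 <;>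
    rcases hwu.lt_or_gt with h3 | h3
  · omega
  · have := extremalColor_eq_of_lt_of_lt h1 h2 hw; grind
  · have := extremalColor_eq_of_lt_of_lt h3 h1 hv; grind
  · have := extremalColor_eq_of_lt_of_lt h3 h2 hv; grind
  · have := extremalColor_eq_of_lt_of_lt h2 h3 hu; grind
  · have := extremalColor_eq_of_lt_of_lt h1 h3 hw; grind
  · have := extremalColor_eq_of_lt_of_lt h2 h1 hu; grind
  · omega

/-- The extremal coloring of the edges of `Kpartite r n`. -/
def extremalColoring (r : ℕ) (n : ℕ → ℕ) : Sym2 ((i : Fin r) × Fin (n i)) → ℕ × ℕ × ℕ :=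
  Sym2.lift ⟨fun v w => extremalColor r (v.1, v.2) (w.1, w.2), fun _ _ => extremalColor_comm _ _ _⟩

lemma kpartite_adj {r : ℕ} {n : ℕ → ℕ} {v w : (i : Fin r) × Fin (n i)} :
    (Kpartite r n).Adj v w ↔ (v.1 : ℕ) ≠ w.1 := by
  simp [Kpartite, Fin.ext_iff]

lemma not_rainbowC3_extremalColoring (r : ℕ) (n : ℕ → ℕ) :
    ¬ RainbowC3 (Kpartite r n) (extremalColoring r n) := by
  rintro ⟨x, y, z, h1, h2, h3, h4, h5, h6⟩
  rw [kpartite_adj] at h1 h2 h3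
  rcases extremalColor_not_rainbow (r := r) (u := (x.1, x.2)) (v := (y.1, y.2)) (w := (z.1, z.2))
    x.1.2 y.1.2 z.1.2 h1 h2 h3 with h | h | h
  exacts [h4 h, h5 h, h6 h]

lemma exists_edge_extremalColoring {r i j x y : ℕ} {n : ℕ → ℕ} (hij : i < j) (hj : j < r)
    (hx : x < n i) (hy : y < n j) :
    ∃ e ∈ (Kpartite r n).edgeSet, extremalColoring r n e = extremalColorOfLt r i x j y := by
  refine ⟨s(⟨⟨i, hij.trans hj⟩, ⟨x, hx⟩⟩, ⟨⟨j, hj⟩, ⟨y, hy⟩⟩), ?_, ?_⟩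
  · rw [SimpleGraph.mem_edgeSet, kpartite_adj]; exact hij.ne
  · simp [extremalColoring, extremalColor, hij]

/-- The colors of the extremal coloring on edges within pairs of parts, and between them. -/
def pairedColors (r : ℕ) (n : ℕ → ℕ) : Finset (ℕ × ℕ × ℕ) :=
  (range (r / 2)).biUnion (fun m =>
    {m} ×ˢ ((range (n (2 * m))).image (· + 1) ×ˢ range (n (2 * m + 1)))) ∪
  (range (r / 2 - 1)).image fun m => (m + 1, 0, 0)

lemma card_pairedColors (r : ℕ) (n : ℕ → ℕ) :
    #(pairedColors r n) = (∑ i ∈ range (r / 2), n (2 * i) * n (2 * i + 1)) + (r / 2 - 1) := by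
  rw [pairedColors, card_union_of_disjoint, card_biUnion, card_image_of_injective, card_range]
  · congr 1
    refine sum_congr rfl fun i _ => ?_
    rw [card_product, card_product, card_image_of_injective _ (add_left_injective 1)]
    simp
  · intro a b h; simpa using h
  · intro a _ b _ hab
    rw [Function.onFun, disjoint_left]
    rintro ⟨m, t⟩ h1 h2
    simp only [mem_product, mem_singleton] at h1 h2
    exact hab (h1.1.symm.trans h2.1)
  · rw [disjoint_left]
    rintro ⟨m, x, y⟩ h1 h2
    simp only [mem_biUnion, mem_product, mem_image, Prod.mk.injEq] at h1 h2
    obtain ⟨_, _, _, ⟨_, _, h⟩, _⟩ := h1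
    obtain ⟨_, _, _, h', _⟩ := h2
    omega

lemma exists_edge_of_mem_pairedColors {r : ℕ} {n : ℕ → ℕ} (hpos : ∀ i < r, 1 ≤ n i)
    {γ : ℕ × ℕ × ℕ} (hγ : γ ∈ pairedColors r n) :
    ∃ e ∈ (Kpartite r n).edgeSet, extremalColoring r n e = γ := by
  simp only [pairedColors, mem_union, mem_biUnion, mem_product, mem_image, mem_range,
    mem_singleton] at hγ
  rcases hγ with ⟨m, hm, h1, ⟨x, hx, h2⟩, h3⟩ | ⟨m, hm, rfl⟩
  · obtain ⟨e, he, h⟩ := exists_edge_extremalColoring (r := r) (n := n)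
      (show 2 * m < 2 * m + 1 by omega) (by omega) hx h3
    refine ⟨e, he, ?_⟩
    rw [h, extremalColorOfLt, if_pos (by omega)]
    ext <;> simp <;> omega
  · obtain ⟨e, he, h⟩ := exists_edge_extremalColoring (r := r) (n := n) (i := 0)
      (show 0 < 2 * (m + 1) by omega) (by omega) (hpos 0 (by omega)) (hpos _ (by omega))
    refine ⟨e, he, ?_⟩
    rw [h, extremalColorOfLt, if_neg (by omega)]
    ext <;> simp

lemma partSize_univ (r : ℕ) (n : ℕ → ℕ) (i : ℕ) :
    partSize (fun v : (i : Fin r) × Fin (n i) => (v.1 : ℕ)) univ i = if i < r then n i else 0 := by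
  unfold partSize
  split_ifs with hi
  · rw [← Fintype.card_fin (n i), ← card_univ]
    refine (card_nbij (fun x => ⟨⟨i, hi⟩, x⟩) (by simp) ?_ ?_).symm
    · intro x _ y _ h
      simpa using h
    · rintro ⟨⟨j, hj⟩, x⟩ h
      simp only [coe_filter, mem_univ, true_and, Set.mem_ofPred_eq] at h
      subst h
      exact ⟨x, by simp⟩
  · rw [card_eq_zero, filter_eq_empty_iff]
    rintro v - rfl
    exact hi v.1.2

lemma card_add_one_le_of_not_rainbowC3 {r k N : ℕ} {n : ℕ → ℕ} (hr : 0 < r) (hN : r ≤ 2 * N)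
    (hmono : ∀ i j : ℕ, i ≤ j → j < r → n j ≤ n i) (hpos : ∀ i : ℕ, i < r → 1 ≤ n i)
    {c : Sym2 ((i : Fin r) × Fin (n i)) → Fin k} (hsurj : SurjOnEdges (Kpartite r n) c)
    (hc : ¬ RainbowC3 (Kpartite r n) c) :
    k + 1 ≤ ∑ i ∈ range N, pairValue (if 2 * i < r then n (2 * i) else 0)
      (if 2 * i + 1 < r then n (2 * i + 1) else 0) := by
  let p : (i : Fin r) × Fin (n i) → ℕ := fun v => v.1
  obtain ⟨σ, hσ, hle⟩ := exists_pairing_card_edgeColors_le (p := p) (c := fun v w => c s(v, w))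
    (exists_isPairing_range N) (fun x y => by rw [Sym2.eq_swap])
    (fun x y z hxy hyz hxz => by
      by_contra hcon
      push Not at hcon
      refine hc ⟨x, y, z, kpartite_adj.mpr hxy, kpartite_adj.mpr hyz, kpartite_adj.mpr hxz.symm, ?_⟩
      rw [Sym2.eq_swap (a := z)]
      exact hcon)
    univ ⟨⟨⟨0, hr⟩, ⟨0, hpos 0 hr⟩⟩, mem_univ _⟩
    fun v _ => mem_range.mpr (v.1.2.trans_le hN)
  have hcolors : edgeColors p (fun v w => c s(v, w)) univ = univ := by
    refine eq_univ_of_forall fun i => ?_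
    obtain ⟨e, he, rfl⟩ := hsurj i
    induction e using Sym2.ind with
    | _ v w =>
      rw [SimpleGraph.mem_edgeSet, kpartite_adj] at he
      exact mem_edgeColors.mpr ⟨v, mem_univ _, w, mem_univ _, he, rfl⟩
  have hsize : partSize p univ = fun i => if i < r then n i else 0 := funext (partSize_univ r n)
  have hanti : Antitone fun i => if i < r then n i else 0 := by
    intro i j hij
    by_cases hj : j < r
    · simpa [hj, hij.trans_lt hj] using hmono i j hij hj
    · simp [hj]
  rw [hcolors, card_univ, Fintype.card_fin, hsize] at hle
  have := hσ.weight_le hanti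
  omega

/-- The anti-Ramsey number of `C₃` in the complete `r`-partite graph `K_{n₁,…,n_r}`. -/
theorem antiRamsey_C3_complete_multipartite (r : ℕ) (n : ℕ → ℕ) (hr : 3 ≤ r)
    (hmono : ∀ i j : ℕ, i ≤ j → j < r → n j ≤ n i)
    (hpos : ∀ i : ℕ, i < r → 1 ≤ n i) :
    IsGreatest {k : ℕ |
      ∃ c : Sym2 ((i : Fin r) × Fin (n i)) → Fin k,
        SurjOnEdges (Kpartite r n) c ∧ ¬ RainbowC3 (Kpartite r n) c}
      (if Odd r then
        (∑ i ∈ Finset.range ((r - 1) / 2), n (2 * i) * n (2 * i + 1)) + n (r - 1)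
          + (r - 1) / 2 - 1
       else
        (∑ i ∈ Finset.range (r / 2), n (2 * i) * n (2 * i + 1)) + r / 2 - 1) := by
  have hfirst : 1 ≤ ∑ i ∈ range (r / 2), n (2 * i) * n (2 * i + 1) :=
    (Nat.mul_pos (hpos 0 (by omega)) (hpos 1 (by omega))).trans_le
      (single_le_sum (f := fun i => n (2 * i) * n (2 * i + 1)) (fun _ _ => Nat.zero_le _)
        (mem_range.mpr (by omega : 0 < r / 2)))
  have hpairs : ∑ i ∈ range (r / 2), pairValue (if 2 * i < r then n (2 * i) else 0)
      (if 2 * i + 1 < r then n (2 * i + 1) else 0) =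
      (∑ i ∈ range (r / 2), n (2 * i) * n (2 * i + 1)) + r / 2 := by
    trans ∑ i ∈ range (r / 2), (n (2 * i) * n (2 * i + 1) + 1)
    swap
    · simp [sum_add_distrib]
    refine sum_congr rfl fun i hi => ?_
    rw [mem_range] at hi
    rw [if_pos (by omega), if_pos (by omega), pairValue_of_pos] <;> exact hpos _ (by omega)
  split_ifs with hodd
  · have hr2 : r = 2 * (r / 2) + 1 := by obtain ⟨m, rfl⟩ := hodd; omega
    rw [show (r - 1) / 2 = r / 2 by omega]
    constructor
    · have hdisj : Disjoint (pairedColors r n)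
          ((range (n (r - 1))).image fun y => (r / 2, 0, y)) := by
        rw [disjoint_left]
        rintro ⟨m, x, y⟩ h1 h2
        simp only [pairedColors, mem_union, mem_biUnion, mem_product, mem_image, mem_range,
          mem_singleton, Prod.mk.injEq] at h1 h2
        obtain ⟨_, _, h, _⟩ := h2
        rcases h1 with ⟨m', h1, h3, -⟩ | ⟨m', h1, h3, -⟩ <;> omega
      refine exists_surjOnEdges_of_card_le (by omega) (not_rainbowC3_extremalColoring r n)
        (pairedColors r n ∪ (range (n (r - 1))).image fun y => (r / 2, 0, y)) ?_ fun γ hγ => ?_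
      · rw [card_union_of_disjoint hdisj, card_pairedColors,
          card_image_of_injective _ (fun a b h => by simpa using h), card_range]
        omega
      · rcases mem_union.mp hγ with hγ | hγ
        · exact exists_edge_of_mem_pairedColors hpos hγ
        · obtain ⟨y, hy, rfl⟩ := mem_image.mp hγ
          obtain ⟨e, he, h⟩ := exists_edge_extremalColoring (r := r) (n := n) (i := 0)
            (show 0 < r - 1 by omega) (by omega) (hpos 0 (by omega)) (mem_range.mp hy)
          refine ⟨e, he, ?_⟩
          rw [h, extremalColorOfLt, if_neg (by omega), if_pos ⟨by omega, hodd⟩,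
            show (r - 1) / 2 = r / 2 by omega]
    · rintro k ⟨c, hsurj, hc⟩
      have := card_add_one_le_of_not_rainbowC3 (N := r / 2 + 1) (by omega) (by omega) hmono hpos
        hsurj hc
      rw [sum_range_succ, hpairs, if_pos (by omega), if_neg (by omega), pairValue_zero_right,
        show 2 * (r / 2) = r - 1 by omega] at this
      omega
  · have hr2 : r = 2 * (r / 2) := by
      obtain ⟨m, rfl⟩ := Nat.not_odd_iff_even.mp hodd; omega
    constructor
    · refine exists_surjOnEdges_of_card_le (by omega) (not_rainbowC3_extremalColoring r n)
        (pairedColors r n) ?_ fun γ hγ => exists_edge_of_mem_pairedColors hpos hγ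
      rw [card_pairedColors]
      omega
    · rintro k ⟨c, hsurj, hc⟩
      have := card_add_one_le_of_not_rainbowC3 (N := r / 2) (by omega) (by omega) hmono hpos
        hsurj hc
      rw [hpairs] at this
      omega
end

section
/- Let r ≥ 3 and n₁ ≥ n₂ ≥ ⋯ ≥ n_r ≥ 1. If G is a subgraph of the complete r-partite graph K_{n₁,n₂,…,n_r} that contains no multipartite cycle, then the number of edges of G is at most n₁n₂ + n₃n₄ + ⋯ + n_{r−2}n_{r−1} + n_r + (r−1)/2 − 1 when r is odd, and at most n₁n₂ + n₃n₄ + ⋯ + n_{r−1}n_r + r/2 − 1 when r is even. -/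
open Finset

/-- `G` (a subgraph of an `r`-partite graph) contains a cycle whose vertex set meets
at least three distinct parts. -/
def HasMultipartiteCycle {r : ℕ} {n : ℕ → ℕ}
    (G : SimpleGraph ((i : Fin r) × Fin (n i))) : Prop :=
  ∃ (v : (i : Fin r) × Fin (n i)) (w : G.Walk v v), w.IsCycle ∧
    3 ≤ (w.support.map Sigma.fst).toFinset.card

/-- `G` contains a path on three vertices meeting three distinct parts. -/
def HasMultipartiteP3 {r : ℕ} {n : ℕ → ℕ}
    (G : SimpleGraph ((i : Fin r) × Fin (n i))) : Prop :=
  ∃ x y z : (i : Fin r) × Fin (n i), G.Adj x y ∧ G.Adj y z ∧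
    x.1 ≠ y.1 ∧ y.1 ≠ z.1 ∧ x.1 ≠ z.1


/-- An ordering of the vertices of a tree in which every vertex has at most one earlier
neighbour. -/
lemma SimpleGraph.IsTree.exists_ordering {V : Type*} [Finite V] {T : SimpleGraph V}
    (hT : T.IsTree) :
    ∃ f : V → ℕ, Function.Injective f ∧
      ∀ u w v, T.Adj u v → T.Adj w v → f u < f v → f w < f v → u = w := by
  have := Fintype.ofFinite V
  classical
  obtain ⟨ρ⟩ := hT.connected.nonempty
  set e := Fintype.equivFin V
  set N := Fintype.card V
  have hlt : ∀ v, (e v : ℕ) < N := fun v => (e v).isLt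
  have key : ∀ w v, T.Adj w v → T.dist ρ w * N + e w < T.dist ρ v * N + e v →
      T.dist ρ w < T.dist ρ v := by
    intro w v hwv h
    rcases hT.dist_eq_dist_add_one_of_adj ρ hwv with h' | h'
    · have := hlt v
      rw [h'] at h
      nlinarith
    · omega
  refine ⟨fun v => T.dist ρ v * N + e v, ?_, ?_⟩
  · intro a b hab
    apply e.injective
    apply Fin.ext
    have h := congrArg (· % N) hab
    simpa [Nat.add_mod, Nat.mod_eq_of_lt (hlt _)] using h
  · intro u w v huv hwv hu hw
    obtain ⟨p, hp, -⟩ := (hT.connected ρ v).exists_path_of_dist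
    have aux : ∀ x, T.Adj x v → T.dist ρ x < T.dist ρ v → x = p.penultimate := by
      intro x hx hd
      obtain ⟨q, hq, hql⟩ := (hT.connected ρ x).exists_path_of_dist
      have hv : v ∉ q.support := by
        intro hv
        have h1 := SimpleGraph.dist_le (q.takeUntil v hv)
        have h2 := q.length_takeUntil_le_length hv
        omega
      exact hT.isAcyclic.eq_penultimate_of_adj_end hp hx.symm
        (hT.isAcyclic.mem_support_of_ne_mem_support_of_adj_of_isPath hp hq hx.symm hv)
    rw [aux u huv (key _ _ huv hu), aux w hwv (key _ _ hwv hw)]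

lemma SimpleGraph.Walk.IsPath.lt_of_ordering {V : Type*} {H : SimpleGraph V} {f : V → ℕ}
    (hf : Function.Injective f)
    (hu : ∀ u w v, H.Adj u v → H.Adj w v → f u < f v → f w < f v → u = w)
    {a b : V} (p : H.Walk a b) (hp : p.IsPath) {c : V} (hca : H.Adj c a) (hc : c ∉ p.support)
    (hlt : f c < f a) : f c < f b := by
  induction p generalizing c with
  | nil => exact hlt
  | @cons a a' b h p ih =>
    rw [SimpleGraph.Walk.cons_isPath_iff] at hp
    have hne : f a ≠ f a' := fun h' => h.ne (hf h')
    have haa : f a < f a' := by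
      by_contra hcon
      have := hu c a' a hca h.symm hlt (by omega)
      subst this
      simp at hc
    exact hlt.trans (ih hp.1 h hp.2 haa)

/-- In an ordering with at most one earlier neighbour per vertex, a vertex that is not the
earliest of its component has an earlier neighbour. -/
lemma SimpleGraph.Reachable.exists_adj_lt {V : Type*} {H : SimpleGraph V} {f : V → ℕ}
    (hf : Function.Injective f)
    (hu : ∀ u w v, H.Adj u v → H.Adj w v → f u < f v → f w < f v → u = w)
    {u v : V} (h : H.Reachable u v) (hlt : f u < f v) : ∃ w, H.Adj w v ∧ f w < f v := by
  obtain ⟨p, hp⟩ := h.symm.exists_isPath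
  cases p with
  | nil => omega
  | @cons _ a _ hva p =>
    refine ⟨a, hva.symm, ?_⟩
    by_contra hcon
    rw [SimpleGraph.Walk.cons_isPath_iff] at hp
    have hne : f v ≠ f a := fun h' => hva.ne (hf h')
    have := hp.1.lt_of_ordering hf hu p hva hp.2 (by omega)
    omega

/-- The subgraph of `T` formed by the edges joining part `P.1` and part `P.2`. -/
def betweenParts {V κ : Type*} (T : SimpleGraph V) (part : V → κ) (P : κ × κ) :
    SimpleGraph V where
  Adj u v := T.Adj u v ∧ ((part u = P.1 ∧ part v = P.2) ∨ (part u = P.2 ∧ part v = P.1))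
  symm := ⟨fun u v h => ⟨h.1.symm, by tauto⟩⟩
  loopless := ⟨fun u h => h.1.ne rfl⟩

lemma betweenParts_mono {V κ : Type*} {F T : SimpleGraph V} (h : F ≤ T) (part : V → κ)
    (P : κ × κ) : betweenParts F part P ≤ betweenParts T part P := fun _ _ hab => ⟨h hab.1, hab.2⟩

lemma eq_of_betweenParts_reachable {V κ : Type*} [LinearOrder κ] {T : SimpleGraph V}
    {part : V → κ} {f : V → ℕ} (hf : Function.Injective f)
    (hu : ∀ u w v, T.Adj u v → T.Adj w v → f u < f v → f w < f v → u = w)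
    {P Q : κ × κ} (hP : P.1 < P.2) (hQ : Q.1 < Q.2) {u w v : V}
    (h1 : (betweenParts T part P).Reachable u v) (h1' : f u < f v)
    (h2 : (betweenParts T part Q).Reachable w v) (h2' : f w < f v) : P = Q := by
  obtain ⟨a, ha, hav⟩ := h1.exists_adj_lt hf
    (fun u w v (hu' : T.Adj u v ∧ _) (hw : T.Adj w v ∧ _) => hu u w v hu'.1 hw.1) h1'
  obtain ⟨b, hb, hbv⟩ := h2.exists_adj_lt hf
    (fun u w v (hu' : T.Adj u v ∧ _) (hw : T.Adj w v ∧ _) => hu u w v hu'.1 hw.1) h2'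
  obtain rfl := hu a b v ha.1 hb.1 hav hbv
  have h3 := ha.2
  have h4 := hb.2
  apply Prod.ext <;> grind

open Classical in
/-- The components of the graphs between two parts restrict to any set of vertices `{v | W v}`
like the hyperedges of a hyperforest. -/
lemma sum_component_card_sub_one_le {V κ : Type*} [Fintype V] [DecidableEq V] [LinearOrder κ]
    [Fintype κ]
    {T : SimpleGraph V} {part : V → κ} {f : V → ℕ} (hf : Function.Injective f)
    (hu : ∀ u w v, T.Adj u v → T.Adj w v → f u < f v → f w < f v → u = w)
    (W : V → Prop) [DecidablePred W] (hW : ∃ v, W v) :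
    ∑ P : κ × κ with P.1 < P.2, ∑ C : (betweenParts T part P).ConnectedComponent,
      (#{v | W v ∧ (betweenParts T part P).connectedComponentMk v = C} - 1)
      ≤ #{v | W v} - 1 := by
  let B : κ × κ → Finset V := fun P =>
    {v | W v ∧ ∃ u, W u ∧ (betweenParts T part P).Reachable u v ∧ f u < f v}
  have h1 : ∀ P, ∑ C : (betweenParts T part P).ConnectedComponent,
      (#{v | W v ∧ (betweenParts T part P).connectedComponentMk v = C} - 1) ≤ #(B P) := by
    intro P
    rw [Finset.card_eq_sum_card_fiberwise
      (f := (betweenParts T part P).connectedComponentMk) (t := Finset.univ) (by simp)]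
    refine Finset.sum_le_sum fun C _ => ?_
    rcases Finset.eq_empty_or_nonempty
      ({v | W v ∧ (betweenParts T part P).connectedComponentMk v = C} : Finset V) with h | h
    · simp [h]
    · obtain ⟨a, ha, hmin⟩ := Finset.exists_min_image _ f h
      rw [← Finset.card_erase_of_mem ha]
      refine Finset.card_le_card fun v hv => ?_
      simp only [Finset.mem_erase, Finset.mem_filter, Finset.mem_univ, true_and] at hv ha
      simp only [B, Finset.mem_filter, Finset.mem_univ, true_and]
      refine ⟨⟨hv.2.1, a, ha.1, ?_, ?_⟩, hv.2.2⟩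
      · exact SimpleGraph.ConnectedComponent.exact (ha.2.trans hv.2.2.symm)
      · refine lt_of_le_of_ne (hmin v (by simpa using hv.2)) fun h' => hv.1 (hf h').symm
  refine (Finset.sum_le_sum fun P _ => h1 P).trans ?_
  rw [← Finset.card_biUnion]
  · obtain ⟨a, ha, hmin⟩ := Finset.exists_min_image ({v | W v} : Finset V) f
      (by obtain ⟨v, hv⟩ := hW; exact ⟨v, by simpa using hv⟩)
    rw [← Finset.card_erase_of_mem ha]
    refine Finset.card_le_card fun v hv => ?_
    simp only [Finset.mem_biUnion, Finset.mem_filter, Finset.mem_univ, true_and, B] at hv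
    obtain ⟨P, -, hv, u, hWu, -, hlt⟩ := hv
    simp only [Finset.mem_erase, Finset.mem_filter, Finset.mem_univ, true_and]
    refine ⟨?_, hv⟩
    rintro rfl
    have := hmin u (by simpa using hWu)
    omega
  · intro P hP Q hQ hPQ
    rw [Function.onFun, Finset.disjoint_left]
    intro v hv hv'
    simp only [Finset.mem_filter, Finset.mem_univ, true_and, B, Finset.coe_filter,
      Set.mem_ofPred_eq] at hv hv' hP hQ
    obtain ⟨-, u, -, h3, h4⟩ := hv
    obtain ⟨-, w, -, h5, h6⟩ := hv'
    exact hPQ (eq_of_betweenParts_reachable hf hu hP hQ h3 h4 h5 h6)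

lemma sum_mul_le_sum_mul_max {ι : Type*} (B : Finset ι) (x y : ι → ℕ) :
    B = ∅ ∨ ∃ C ∈ B, ∑ D ∈ B, x D * y D ≤ (∑ D ∈ B, x D) * y C := by
  refine B.eq_empty_or_nonempty.imp_right fun h => ?_
  obtain ⟨C, hC, hmax⟩ := B.exists_max_image y h
  refine ⟨C, hC, ?_⟩
  rw [Finset.sum_mul]
  exact Finset.sum_le_sum fun D hD => Nat.mul_le_mul_left _ (hmax D hD)

/-- If items `C` carry amounts `x C`, `y C` of two distinct resources `p C < q C`, and at most
`m i` of resource `i` is used in total, with `m` decreasing, then `∑ x C * y C` is largest when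
consecutive resources are paired. -/
lemma sum_mul_le_sum_consecutive {ι : Type*} [DecidableEq ι] {m : ℕ → ℕ} (hm : Antitone m)
    (K : ℕ) : ∀ (k : ℕ) (S : Finset ι) (p q : ι → ℕ) (x y : ι → ℕ),
    (∀ C ∈ S, k ≤ p C ∧ p C < q C ∧ q C ≤ k + 2 * K) →
    (∀ i, ∑ C ∈ S, ((if p C = i then x C else 0) + (if q C = i then y C else 0)) ≤ m i) →
    ∑ C ∈ S, x C * y C ≤ ∑ t ∈ range K, m (k + 2 * t) * m (k + 2 * t + 1) := by
  induction K with
  | zero =>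
    intro k S p q x y h1 _
    have : S = ∅ := by
      refine Finset.eq_empty_of_forall_notMem fun C hC => ?_
      have := h1 C hC
      omega
    simp [this]
  | succ K ih =>
    intro k S p q x y h1 h2
    set w : ℕ → ι → ℕ := fun i C =>
      (if p C = i then x C else 0) + (if q C = i then y C else 0) with hw
    have hsub : ∀ S' ⊆ S, ∀ i, ∑ C ∈ S', w i C ≤ m i := fun S' hS' i =>
      (Finset.sum_le_sum_of_subset hS').trans (h2 i)
    set A := S.filter (p · = k) with hA
    set B := S.filter (p · = k + 1) with hB
    set R := S.filter (k + 2 ≤ p ·) with hR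
    have hsplit : ∑ C ∈ S, x C * y C
        = ∑ C ∈ A, x C * y C + ∑ C ∈ B, x C * y C + ∑ C ∈ R, x C * y C := by
      rw [hA, hB, hR, Finset.sum_filter, Finset.sum_filter, Finset.sum_filter,
        ← Finset.sum_add_distrib, ← Finset.sum_add_distrib]
      refine Finset.sum_congr rfl fun C hC => ?_
      have := (h1 C hC).1
      by_cases ha : p C = k
      · simp [ha]
      · by_cases hb : p C = k + 1
        · simp [hb]
        · simp [ha, hb, show k + 2 ≤ p C by omega]
    set F := ∑ t ∈ range K, m (k + 2 + 2 * t) * m (k + 2 + 2 * t + 1) with hF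
    have htarget : ∑ t ∈ range (K + 1), m (k + 2 * t) * m (k + 2 * t + 1)
        = m k * m (k + 1) + F := by
      rw [Finset.sum_range_succ', add_comm]
      simp only [hF, mul_zero, add_zero]
      congr 1
      refine Finset.sum_congr rfl fun t _ => ?_
      rw [show k + 2 * (t + 1) = k + 2 + 2 * t by ring]
    rw [htarget, hsplit]
    have hRF : ∑ C ∈ R, x C * y C ≤ F := by
      refine ih (k + 2) R p q x y (fun C hC => ?_) (hsub R (Finset.filter_subset _ _))
      have := h1 C (Finset.mem_of_mem_filter C hC)
      have := (Finset.mem_filter.1 hC).2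
      omega
    have hyq : ∀ C ∈ S, y C ≤ m (q C) := fun C hC => by
      have := hsub {C} (by simpa using hC) (q C)
      simp only [hw, Finset.sum_singleton, if_true] at this
      omega
    have hxA : ∑ C ∈ A, x C ≤ m k := by
      refine le_trans (Finset.sum_le_sum fun C hC => ?_) (hsub A (Finset.filter_subset _ _) k)
      simp [hw, (Finset.mem_filter.1 hC).2]
    have hxB' : ∑ C ∈ B, x C ≤ ∑ C ∈ B, w (k + 1) C :=
      Finset.sum_le_sum fun C hC => by simp [hw, (Finset.mem_filter.1 hC).2]
    have hxB : ∑ C ∈ B, x C ≤ m (k + 1) := hxB'.trans (hsub B (Finset.filter_subset _ _) _)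
    have hmk : m (k + 1) ≤ m k := hm (by omega)
    suffices h : ∑ C ∈ A, x C * y C + ∑ C ∈ B, x C * y C ≤ m k * m (k + 1) ∨
        ∑ C ∈ A, x C * y C + ∑ C ∈ B, x C * y C + ∑ C ∈ R, x C * y C ≤ m k * m (k + 1) + F by
      rcases h with h | h <;> omega
    rcases sum_mul_le_sum_mul_max A x y with hAe | ⟨C, hC, hAC⟩
    · left
      rw [hAe, Finset.sum_empty, zero_add]
      rcases sum_mul_le_sum_mul_max B x y with hBe | ⟨D, hD, hBD⟩
      · simp [hBe]
      · have hD' := Finset.mem_filter.1 hD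
        have h3 : m (q D) ≤ m k := hm (by have := h1 D hD'.1; omega)
        calc _ ≤ _ := hBD
          _ ≤ m (k + 1) * m k := Nat.mul_le_mul hxB ((hyq D hD'.1).trans h3)
          _ = _ := mul_comm _ _
    have hC' := Finset.mem_filter.1 hC
    have hqC := h1 C hC'.1
    have hyC : y C ≤ m (k + 1) := (hyq C hC'.1).trans (hm (by omega))
    have hAC' : ∑ C ∈ A, x C * y C ≤ m k * y C := hAC.trans (Nat.mul_le_mul_right _ hxA)
    rcases sum_mul_le_sum_mul_max B x y with hBe | ⟨D, hD, hBD⟩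
    · left
      rw [hBe, Finset.sum_empty, add_zero]
      exact hAC'.trans (Nat.mul_le_mul_left _ hyC)
    have hD' := Finset.mem_filter.1 hD
    have hqD := h1 D hD'.1
    have hyD : y D ≤ m k := (hyq D hD'.1).trans (hm (by omega))
    have hCB : C ∉ B := fun h => by have := (Finset.mem_filter.1 h).2; omega
    have hCD : C ≠ D := fun h => hCB (h ▸ hD)
    by_cases hj : q C = k + 1
    · left
      have h3 := hsub (insert C B)
        (Finset.insert_subset hC'.1 (Finset.filter_subset _ _)) (k + 1)
      rw [Finset.sum_insert hCB] at h3
      have h4 : y C ≤ w (k + 1) C := by simp [hw, hj]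
      have h5 : y C + ∑ C ∈ B, x C ≤ m (k + 1) := by omega
      have h6 := Nat.mul_le_mul_left (∑ C ∈ B, x C) hyD
      nlinarith [Nat.mul_le_mul_left (m k) h5]
    have hBD' : ∑ C ∈ B, x C * y C ≤ m (k + 1) * y D :=
      hBD.trans (Nat.mul_le_mul_right _ hxB)
    have hCR : C ∉ R := fun h => by have := (Finset.mem_filter.1 h).2; omega
    have hDR : D ∉ R := fun h => by have := (Finset.mem_filter.1 h).2; omega
    by_cases hjl : q C = q D
    · left
      have h3 := hsub {C, D} (by
        intro E hE
        rcases Finset.mem_insert.1 hE with rfl | hE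
        · exact hC'.1
        · exact (Finset.mem_singleton.1 hE) ▸ hD'.1) (q C)
      rw [Finset.sum_pair hCD] at h3
      have h4 : y C ≤ w (q C) C := by simp [hw]
      have h5 : y D ≤ w (q C) D := by simp [hw, hjl]
      have h6 : m (q C) ≤ m (k + 1) := hm (by omega)
      have h7 : y C + y D ≤ m (k + 1) := by omega
      nlinarith [Nat.mul_le_mul_left (m k) h7, Nat.mul_le_mul_right (y D) hmk]
    right
    have hload : ∀ i, (if q C = i then y C else 0) + (if q D = i then y D else 0)
        + ∑ E ∈ R, w i E ≤ m i := by
      intro i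
      have h3 := hsub (insert C (insert D R)) (by
        refine Finset.insert_subset hC'.1 (Finset.insert_subset hD'.1 (Finset.filter_subset _ _)))
        i
      rw [Finset.sum_insert (by simp [hCD, hCR]), Finset.sum_insert hDR] at h3
      have h4 : (if q C = i then y C else 0) ≤ w i C := by simp [hw]
      have h5 : (if q D = i then y D else 0) ≤ w i D := by simp [hw]
      omega
    -- the two largest resources are paired up, and their former partners with each other
    have aux : ∀ j l a b, k + 2 ≤ j → j < l → l ≤ k + 2 + 2 * K →
        (∀ i, (if j = i then a else 0) + (if l = i then b else 0) + ∑ E ∈ R, w i E ≤ m i) →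
        a * b + ∑ E ∈ R, x E * y E ≤ F := by
      intro j l a b hj hjl hl hab
      have hupd : ∀ {α : Type} (g : ι → α) (a : α), ∀ E ∈ R, Function.update g C a E = g E :=
        fun g a E hE => Function.update_of_ne (fun h => hCR (by rwa [← h])) _ _
      have := ih (k + 2) (insert C R) (Function.update p C j) (Function.update q C l)
        (Function.update x C a) (Function.update y C b) ?_ ?_
      · rw [Finset.sum_insert hCR, Function.update_self, Function.update_self] at this
        refine le_trans (le_of_eq ?_) this
        congr 1
        exact Finset.sum_congr rfl fun E hE => by rw [hupd _ _ E hE, hupd _ _ E hE]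
      · intro E hE
        rcases Finset.mem_insert.1 hE with rfl | hE
        · simp only [Function.update_self]
          omega
        · rw [hupd _ _ E hE, hupd _ _ E hE]
          have := h1 E (Finset.mem_of_mem_filter E hE)
          have := (Finset.mem_filter.1 hE).2
          omega
      · intro i
        rw [Finset.sum_insert hCR]
        simp only [Function.update_self]
        refine le_trans (le_of_eq ?_) (hab i)
        congr 1
        exact Finset.sum_congr rfl fun E hE => by
          rw [hupd _ _ E hE, hupd _ _ E hE, hupd _ _ E hE, hupd _ _ E hE]
    have hfin : y C * y D + ∑ E ∈ R, x E * y E ≤ F := by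
      rcases lt_or_gt_of_ne hjl with h | h
      · exact aux (q C) (q D) (y C) (y D) (by omega) h (by omega) hload
      · rw [mul_comm]
        refine aux (q D) (q C) (y D) (y C) (by omega) h (by omega) fun i => ?_
        rw [add_comm (if q D = i then _ else _)]
        exact hload i
    have hex : m k * y C + m (k + 1) * y D ≤ m k * m (k + 1) + y C * y D := by
      obtain ⟨s, hs⟩ := Nat.exists_eq_add_of_le hyD
      obtain ⟨t, ht⟩ := Nat.exists_eq_add_of_le hyC
      rw [hs, ht]
      nlinarith [Nat.zero_le (s * t)]
    omega

/-- If `G` has no multipartite cycle and `F ≤ G` is a forest with the same components, the ends of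
each edge of `G` are joined in `F` within the two parts of that edge. -/
lemma betweenParts_reachable_of_adj {r : ℕ} {n : ℕ → ℕ}
    {G F : SimpleGraph ((i : Fin r) × Fin (n i))} (hG : G ≤ Kpartite r n)
    (hnc : ¬ HasMultipartiteCycle G) (hF : F ≤ G) (hr : F.Reachable = G.Reachable)
    {u v : (i : Fin r) × Fin (n i)} (huv : G.Adj u v) :
    (betweenParts F Sigma.fst (u.1, v.1)).Reachable u v := by
  classical
  have hne : ∀ {a b}, F.Adj a b → a.1 ≠ b.1 := fun h => hG (hF h)
  by_cases hFuv : F.Adj u v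
  · exact SimpleGraph.Adj.reachable ⟨hFuv, Or.inl ⟨rfl, rfl⟩⟩
  have hreach : F.Reachable u v := by rw [hr]; exact huv.reachable
  obtain ⟨p, hp⟩ := hreach.exists_isPath
  have hsupp : ∀ a ∈ p.support, a.1 = u.1 ∨ a.1 = v.1 := by
    by_contra hcon
    push Not at hcon
    obtain ⟨a, ha, hau, hav⟩ := hcon
    refine hnc ⟨v, SimpleGraph.Walk.cons huv.symm (p.mapLe hF), ?_, ?_⟩
    · rw [SimpleGraph.Walk.cons_isCycle_iff]
      refine ⟨hp.mapLe hF, fun hmem => hFuv ?_⟩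
      rw [SimpleGraph.Walk.edges_mapLe_eq_edges] at hmem
      exact (p.adj_of_mem_edges hmem).symm
    · have huv1 : u.1 ≠ v.1 := hG huv
      rw [← Finset.card_eq_three.2 ⟨u.1, v.1, a.1, huv1, hau.symm, hav.symm, rfl⟩]
      refine Finset.card_le_card fun i hi => ?_
      simp only [Finset.mem_insert, Finset.mem_singleton] at hi
      simp only [SimpleGraph.Walk.support_cons, SimpleGraph.Walk.support_mapLe_eq_support,
        List.mem_toFinset, List.mem_map, List.mem_cons]
      rcases hi with rfl | rfl | rfl
      · exact ⟨u, Or.inr p.start_mem_support, rfl⟩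
      · exact ⟨v, Or.inl rfl, rfl⟩
      · exact ⟨a, Or.inr ha, rfl⟩
  refine ⟨p.transfer _ fun e he => ?_⟩
  induction e using Sym2.ind with
  | _ a b =>
    have hab := p.adj_of_mem_edges he
    have ha := hsupp a (p.fst_mem_support_of_mem_edges he)
    have hb := hsupp b (p.snd_mem_support_of_mem_edges he)
    have := hne hab
    refine ⟨hab, ?_⟩
    dsimp only
    grind

open Classical in
lemma ncard_edgeSet_le_sum_components {r : ℕ} {n : ℕ → ℕ}
    {G T : SimpleGraph ((i : Fin r) × Fin (n i))} (hG : G ≤ Kpartite r n)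
    (h : ∀ u v, G.Adj u v → (betweenParts T Sigma.fst (u.1, v.1)).Reachable u v) :
    G.edgeSet.ncard ≤ ∑ P : Fin r × Fin r with P.1 < P.2,
      ∑ C : (betweenParts T Sigma.fst P).ConnectedComponent,
        #{v | v.1 = P.1 ∧ (betweenParts T Sigma.fst P).connectedComponentMk v = C} *
        #{v | v.1 = P.2 ∧ (betweenParts T Sigma.fst P).connectedComponentMk v = C} := by
  let U : Finset (((i : Fin r) × Fin (n i)) × ((i : Fin r) × Fin (n i))) :=
    ({P : Fin r × Fin r | P.1 < P.2} : Finset _).biUnion fun P =>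
      (Finset.univ : Finset (betweenParts T Sigma.fst P).ConnectedComponent).biUnion fun C =>
        ({v | v.1 = P.1 ∧ (betweenParts T Sigma.fst P).connectedComponentMk v = C} : Finset _) ×ˢ
        ({v | v.1 = P.2 ∧ (betweenParts T Sigma.fst P).connectedComponentMk v = C} : Finset _)
  have hU : ∀ u v, G.Adj u v → u.1 < v.1 → (u, v) ∈ U := by
    intro u v huv hlt
    simp only [U, Finset.mem_biUnion, Finset.mem_filter, Finset.mem_univ, true_and,
      Finset.mem_product]
    exact ⟨(u.1, v.1), hlt, _, ⟨rfl, rfl⟩, rfl,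
      (SimpleGraph.ConnectedComponent.sound (h u v huv)).symm⟩
  have hsub : G.edgeSet ⊆ (U.image fun e => s(e.1, e.2) : Finset _) := by
    intro e he
    induction e using Sym2.ind with
    | _ u v =>
      rw [SimpleGraph.mem_edgeSet] at he
      have hne : u.1 ≠ v.1 := hG he
      rw [Finset.mem_coe, Finset.mem_image]
      rcases lt_or_gt_of_ne hne with hlt | hlt
      · exact ⟨(u, v), hU u v he hlt, rfl⟩
      · exact ⟨(v, u), hU v u he.symm hlt, Sym2.eq_swap⟩
  calc G.edgeSet.ncard ≤ #(U.image fun e => s(e.1, e.2)) := by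
        rw [← Set.ncard_coe_finset]
        exact Set.ncard_le_ncard hsub
    _ ≤ #U := Finset.card_image_le
    _ ≤ _ := by
        refine Finset.card_biUnion_le.trans (Finset.sum_le_sum fun P _ => ?_)
        refine Finset.card_biUnion_le.trans (Finset.sum_le_sum fun C _ => ?_)
        rw [Finset.card_product]

lemma mul_le_sub_one_mul_sub_one_add (a b : ℕ) : a * b ≤ (a - 1) * (b - 1) + (a + b - 1) := by
  rcases a with _ | a
  · simp
  rcases b with _ | b
  · simp
  simp only [Nat.add_sub_cancel]
  have : a + 1 + (b + 1) - 1 = a + b + 1 := by omega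
  rw [this]
  nlinarith

lemma card_part_le {r : ℕ} (n : ℕ → ℕ) (i : Fin r) :
    #{v : (i : Fin r) × Fin (n i) | v.1 = i} ≤ n i := by
  have : ({v : (i : Fin r) × Fin (n i) | v.1 = i} : Finset _) ⊆
      Finset.univ.image fun a : Fin (n i) => ⟨i, a⟩ := by
    rintro ⟨j, a⟩ hv
    obtain rfl : j = i := by simpa using hv
    exact Finset.mem_image_of_mem _ (Finset.mem_univ a)
  exact (Finset.card_le_card this).trans (Finset.card_image_le.trans (by simp))

lemma edge_bound_sub_one {r : ℕ} {n : ℕ → ℕ} (hr : 3 ≤ r)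
    (hmono : ∀ i j : ℕ, i ≤ j → j < r → n j ≤ n i) (hpos : ∀ i : ℕ, i < r → 1 ≤ n i)
    {G : SimpleGraph ((i : Fin r) × Fin (n i))} (hG : G ≤ Kpartite r n)
    (hnc : ¬ HasMultipartiteCycle G) :
    G.edgeSet.ncard ≤ ((∑ i ∈ range r, n i) - 1) +
      ∑ t ∈ range (r / 2), (n (2 * t) - 1) * (n (2 * t + 1) - 1) := by
  classical
  obtain ⟨F, hFG, hFa, hFr⟩ := G.exists_isAcyclic_reachable_eq_le
  let v₀ : (i : Fin r) × Fin (n i) := ⟨⟨0, by omega⟩, ⟨0, hpos 0 (by omega)⟩⟩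
  have : Nonempty ((i : Fin r) × Fin (n i)) := ⟨v₀⟩
  obtain ⟨T, hFT, -, hT⟩ :=
    SimpleGraph.connected_top.exists_isTree_le_of_le_of_isAcyclic le_top hFa
  obtain ⟨f, hf, hu⟩ := hT.exists_ordering
  have hreach : ∀ u v, G.Adj u v → (betweenParts T Sigma.fst (u.1, v.1)).Reachable u v :=
    fun u v huv => (betweenParts_reachable_of_adj hG hnc hFG hFr huv).mono
      (betweenParts_mono hFT _ _)
  refine (ncard_edgeSet_le_sum_components hG hreach).trans ?_
  let c : (P : Fin r × Fin r) → (betweenParts T Sigma.fst P).ConnectedComponent → Fin r → ℕ :=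
    fun P C i => #{v | v.1 = i ∧ (betweenParts T Sigma.fst P).connectedComponentMk v = C}
  have hcard : ∀ (P : Fin r × Fin r) C, P.1 < P.2 → c P C P.1 * c P C P.2 ≤
      (#{v | True ∧ (betweenParts T Sigma.fst P).connectedComponentMk v = C} - 1) +
        (c P C P.1 - 1) * (c P C P.2 - 1) := by
    intro P C hP
    have h1 : c P C P.1 + c P C P.2 ≤
        #{v | True ∧ (betweenParts T Sigma.fst P).connectedComponentMk v = C} := by
      simp only [c]
      rw [← Finset.card_union_of_disjoint]
      · refine Finset.card_le_card fun v => ?_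
        simp only [Finset.mem_union, Finset.mem_filter, Finset.mem_univ, true_and]
        tauto
      · rw [Finset.disjoint_left]
        intro v h3 h4
        simp only [Finset.mem_filter, Finset.mem_univ, true_and] at h3 h4
        exact hP.ne (h3.1.symm.trans h4.1)
    have := mul_le_sub_one_mul_sub_one_add (c P C P.1) (c P C P.2)
    omega
  have hsum : ∑ P : Fin r × Fin r with P.1 < P.2,
        ∑ C : (betweenParts T Sigma.fst P).ConnectedComponent, c P C P.1 * c P C P.2 ≤
      ∑ P : Fin r × Fin r with P.1 < P.2,
        ∑ C : (betweenParts T Sigma.fst P).ConnectedComponent,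
        (#{v | True ∧ (betweenParts T Sigma.fst P).connectedComponentMk v = C} - 1) +
      ∑ P : Fin r × Fin r with P.1 < P.2,
        ∑ C : (betweenParts T Sigma.fst P).ConnectedComponent,
          (c P C P.1 - 1) * (c P C P.2 - 1) := by
    rw [← Finset.sum_add_distrib]
    refine Finset.sum_le_sum fun P hP => ?_
    rw [← Finset.sum_add_distrib]
    exact Finset.sum_le_sum fun C _ => hcard P C (by simpa using hP)
  refine hsum.trans (add_le_add ?_ ?_)
  · have h1 := sum_component_card_sub_one_le hf hu (part := Sigma.fst)
      (fun _ : (i : Fin r) × Fin (n i) => True) ⟨v₀, trivial⟩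
    have h2 : #{v : (i : Fin r) × Fin (n i) | True} = ∑ i ∈ range r, n i := by
      simp [Finset.sum_range]
    rw [h2] at h1
    exact h1
  · let m : ℕ → ℕ := fun i => if i < r then n i - 1 else 0
    have hm : Antitone m := by
      intro i j hij
      simp only [m]
      split_ifs with h1 h2
      · have := hmono i j hij h1
        omega
      · omega
      · omega
      · omega
    have key := sum_mul_le_sum_consecutive hm (r / 2) 0
      (({P : Fin r × Fin r | P.1 < P.2} : Finset _).sigma fun P =>
        (Finset.univ : Finset (betweenParts T Sigma.fst P).ConnectedComponent))
      (fun C => C.1.1) (fun C => C.1.2)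
      (fun C => c C.1 C.2 C.1.1 - 1) (fun C => c C.1 C.2 C.1.2 - 1) ?_ ?_
    · rw [Finset.sum_sigma] at key
      refine key.trans (le_of_eq (Finset.sum_congr rfl fun t ht => ?_))
      have := Finset.mem_range.1 ht
      simp only [m, zero_add]
      rw [if_pos (by omega), if_pos (by omega)]
    · intro C hC
      simp only [Finset.mem_sigma, Finset.mem_filter, Finset.mem_univ, true_and, and_true] at hC
      have h1 : (C.1.1 : ℕ) < C.1.2 := hC
      have h2 := C.1.2.isLt
      omega
    · intro i
      rw [Finset.sum_sigma]
      by_cases hi : i < r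
      · have h1 := sum_component_card_sub_one_le hf hu (part := Sigma.fst)
          (fun v : (i : Fin r) × Fin (n i) => v.1 = ⟨i, hi⟩)
          ⟨⟨⟨i, hi⟩, ⟨0, hpos i hi⟩⟩, rfl⟩
        have h2 := card_part_le n ⟨i, hi⟩
        have h3 : m i = n i - 1 := if_pos hi
        rw [h3]
        refine le_trans ?_ (h1.trans (Nat.sub_le_sub_right h2 1))
        refine Finset.sum_le_sum fun P hP => ?_
        refine Finset.sum_le_sum fun C _ => ?_
        have hP : P.1 < P.2 := by simpa using hP
        change (if (P.1 : ℕ) = i then c P C P.1 - 1 else 0) +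
          (if (P.2 : ℕ) = i then c P C P.2 - 1 else 0) ≤ c P C ⟨i, hi⟩ - 1
        have hP' : (P.1 : ℕ) < P.2 := hP
        by_cases ha : (P.1 : ℕ) = i
        · have hb : (P.2 : ℕ) ≠ i := by omega
          have : P.1 = ⟨i, hi⟩ := Fin.ext ha
          rw [if_pos ha, if_neg hb, ← this, add_zero]
        · rw [if_neg ha, zero_add]
          split_ifs with hb
          · have : P.2 = ⟨i, hi⟩ := Fin.ext hb
            rw [← this]
          · exact Nat.zero_le _
      · rw [Finset.sum_eq_zero fun P _ => Finset.sum_eq_zero fun C _ => ?_]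
        · exact Nat.zero_le _
        · have h1 := P.1.isLt
          have h2 := P.2.isLt
          rw [if_neg (by omega), if_neg (by omega), add_zero]

lemma sum_consecutive_sub_one {n : ℕ → ℕ} (K : ℕ) (hpos : ∀ i < 2 * K, 1 ≤ n i) :
    (∑ i ∈ range (2 * K), n i) + ∑ t ∈ range K, (n (2 * t) - 1) * (n (2 * t + 1) - 1) =
      (∑ t ∈ range K, n (2 * t) * n (2 * t + 1)) + K := by
  induction K with
  | zero => simp
  | succ K ih =>
    have ih := ih fun i hi => hpos i (by omega)
    rw [show 2 * (K + 1) = 2 * K + 1 + 1 by ring, Finset.sum_range_succ, Finset.sum_range_succ,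
      Finset.sum_range_succ _ K, Finset.sum_range_succ _ K]
    obtain ⟨a, ha⟩ := Nat.exists_eq_add_of_le (hpos (2 * K) (by omega))
    obtain ⟨b, hb⟩ := Nat.exists_eq_add_of_le (hpos (2 * K + 1) (by omega))
    rw [ha, hb]
    simp only [Nat.add_sub_cancel_left]
    nlinarith

/-- A subgraph of the complete `r`-partite graph with no multipartite cycle has at most
`n₁n₂ + n₃n₄ + ⋯ + n_r + (r-1)/2 − 1` (`r` odd), resp.
`n₁n₂ + n₃n₄ + ⋯ + r/2 − 1` (`r` even) edges. -/
theorem edge_bound_no_multipartite_cycle (r : ℕ) (n : ℕ → ℕ) (hr : 3 ≤ r)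
    (hmono : ∀ i j : ℕ, i ≤ j → j < r → n j ≤ n i)
    (hpos : ∀ i : ℕ, i < r → 1 ≤ n i)
    (G : SimpleGraph ((i : Fin r) × Fin (n i))) (hG : G ≤ Kpartite r n)
    (hnc : ¬ HasMultipartiteCycle G) :
    G.edgeSet.ncard ≤
      (if Odd r then
        (∑ i ∈ Finset.range ((r - 1) / 2), n (2 * i) * n (2 * i + 1)) + n (r - 1)
          + (r - 1) / 2 - 1
       else
        (∑ i ∈ Finset.range (r / 2), n (2 * i) * n (2 * i + 1)) + r / 2 - 1) := by
  have h := edge_bound_sub_one hr hmono hpos hG hnc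
  have hK := sum_consecutive_sub_one (r / 2) (fun i hi => hpos i (by omega))
  refine h.trans ?_
  split_ifs with hodd
  · have h1 : r = 2 * (r / 2) + 1 := by
      obtain ⟨k, rfl⟩ := hodd
      omega
    have h2 : ∑ i ∈ range r, n i = (∑ i ∈ range (2 * (r / 2)), n i) + n (r - 1) := by
      conv_lhs => rw [h1, Finset.sum_range_succ]
      congr 2
      omega
    have h3 := hpos (r - 1) (by omega)
    rw [show (r - 1) / 2 = r / 2 by omega, h2]
    omega
  · have h1 : r = 2 * (r / 2) := by
      rw [Nat.not_odd_iff_even] at hodd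
      obtain ⟨k, rfl⟩ := hodd
      omega
    have h2 : ∑ i ∈ range r, n i = ∑ i ∈ range (2 * (r / 2)), n i := by rw [← h1]
    rw [h2]
    have h3 : 1 ≤ ∑ i ∈ range (2 * (r / 2)), n i :=
      (hpos 0 (by omega)).trans
        (Finset.single_le_sum (f := n) (fun _ _ => Nat.zero_le _)
          (Finset.mem_range.2 (by omega)))
    omega
end

section
/- For every integer r ≥ 3 and integers n₁ ≥ n₂ ≥ ⋯ ≥ n_r ≥ 1, every edge-coloring of the complete r-partite graph K_{n₁,n₂,…,n_r} using exactly f(n₁,…,n_r) + 1 colors contains a rainbow 3-cycle, where f(n₁,…,n_r) = n₁n₂ + n₃n₄ + ⋯ + n_{r−2}n_{r−1} + n_r + (r−1)/2 − 1 when r is odd and f(n₁,…,n_r) = n₁n₂ + n₃n₄ + ⋯ + n_{r−1}n_r + r/2 − 1 when r is even. -/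
open Finset

/-- Multiply consecutive entries in pairs, add one for each pair, and add an unpaired last entry. -/
def pairSum : List ℕ → ℕ
  | [] => 0
  | [a] => a
  | a :: b :: l => a * b + 1 + pairSum l

lemma pairSum_append_one : ∀ l : List ℕ, pairSum (l ++ [1]) = pairSum l + 1
  | [] => rfl
  | [a] => by simp [pairSum]
  | a :: b :: l => by
      simp only [List.cons_append, pairSum, pairSum_append_one l]
      ring

lemma add_pairSum_le : ∀ (a : ℕ) (l : List ℕ), (a :: l).Pairwise (· ≥ ·) →
    (∀ x ∈ a :: l, 1 ≤ x) → a + pairSum l ≤ pairSum (a :: l)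
  | a, [], _, _ => by simp [pairSum]
  | a, [b], _, hpos => by
      simp only [List.mem_cons, List.not_mem_nil, or_false, forall_eq_or_imp, forall_eq] at hpos
      simp only [pairSum]
      nlinarith [Nat.mul_le_mul hpos.1 hpos.2, mul_nonneg (sub_nonneg.2 (Int.ofNat_le.2 hpos.1))
        (sub_nonneg.2 (Int.ofNat_le.2 hpos.2))]
  | a, b :: y :: l, hs, hpos => by
      have ih := add_pairSum_le y l (by simp_all [List.pairwise_cons]) (by simp_all)
      have hay : y ≤ a := by simp_all [List.pairwise_cons]
      have hb : 1 ≤ b := hpos b (by simp)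
      simp only [pairSum]
      obtain ⟨d, rfl⟩ := Nat.exists_eq_add_of_le hay
      obtain ⟨k, rfl⟩ := Nat.exists_eq_add_of_le hb
      nlinarith [Nat.zero_le (d * k)]

lemma pairSum_cons_le {a x b : ℕ} (ha : 1 ≤ a) (hxb : x ≤ b) (l : List ℕ) (hl : ∀ y ∈ l, y ≤ a) :
    a * x + pairSum (b :: l) ≤ a * b + pairSum (x :: l) := by
  obtain ⟨d, rfl⟩ := Nat.exists_eq_add_of_le hxb
  match l, hl with
  | [], _ =>
      simp only [pairSum]
      nlinarith [Nat.mul_le_mul_right d ha]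
  | y :: l, hl =>
      simp only [pairSum]
      nlinarith [Nat.mul_le_mul_right d (hl y (by simp))]

lemma mul_add_pairSum_le : ∀ (a : ℕ) (l₁ : List ℕ) (x : ℕ) (l₂ : List ℕ),
    (a :: (l₁ ++ x :: l₂)).Pairwise (· ≥ ·) → (∀ y ∈ a :: (l₁ ++ x :: l₂), 1 ≤ y) →
    a * x + 1 + pairSum (l₁ ++ l₂) ≤ pairSum (a :: (l₁ ++ x :: l₂))
  | a, [], x, l₂, _, _ => by simp [pairSum]
  | a, [b], x, l₂, hs, hpos => by
      have := pairSum_cons_le (hpos a (by simp)) (x := x) (b := b)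
        (by simp_all [List.pairwise_cons]) l₂ (by simp_all [List.pairwise_cons])
      simp only [List.cons_append, List.nil_append, pairSum] at this ⊢
      omega
  | a, b :: y :: l₁, x, l₂, hs, hpos => by
      simp only [List.cons_append] at hs hpos
      have ih := mul_add_pairSum_le y l₁ x l₂ (hs.tail.tail)
        (fun z hz => hpos z (List.mem_cons_of_mem _ (List.mem_cons_of_mem _ hz)))
      have hya : y ≤ a := List.rel_of_pairwise_cons hs (by simp)
      have hxb : x ≤ b := List.rel_of_pairwise_cons hs.tail (by simp)
      simp only [List.cons_append, pairSum]
      obtain ⟨d, rfl⟩ := Nat.exists_eq_add_of_le hya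
      obtain ⟨k, rfl⟩ := Nat.exists_eq_add_of_le hxb
      nlinarith [Nat.zero_le (d * k)]

lemma pairSum_map_range : ∀ (r : ℕ) (n : ℕ → ℕ), pairSum ((List.range r).map n) =
    if Odd r then (∑ i ∈ range ((r - 1) / 2), n (2 * i) * n (2 * i + 1)) + n (r - 1) + (r - 1) / 2
    else (∑ i ∈ range (r / 2), n (2 * i) * n (2 * i + 1)) + r / 2
  | 0, n => by simp [pairSum]
  | 1, n => by simp [pairSum]
  | r + 2, n => by
      have ih := pairSum_map_range r (fun i => n (i + 2))
      have hl : (List.range (r + 2)).map n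
          = n 0 :: n 1 :: (List.range r).map (fun i => n (i + 2)) := by
        rw [List.range_succ_eq_map, List.range_succ_eq_map]
        simp [Function.comp_def]
      rw [hl, pairSum, ih]
      have hodd : Odd (r + 2) ↔ Odd r := by simp [Nat.odd_add, parity_simps]
      by_cases h : Odd r
      · obtain ⟨m, rfl⟩ := h
        rw [if_pos (odd_two_mul_add_one m), if_pos (hodd.2 (odd_two_mul_add_one m))]
        rw [show (2 * m + 1 + 2 - 1) / 2 = m + 1 by omega, show (2 * m + 1 - 1) / 2 = m by omega,
          sum_range_succ']
        simp only [show 2 * m + 1 - 1 + 2 = 2 * m + 1 + 2 - 1 by omega, mul_add, mul_one,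
          mul_zero, zero_add, add_right_comm _ 2 1]
        ring
      · rw [if_neg h, if_neg (hodd.not.2 h), show (r + 2) / 2 = r / 2 + 1 by omega,
          sum_range_succ']
        simp only [mul_add, mul_one, mul_zero, zero_add, add_right_comm _ 2 1]
        ring

section Coloring

variable {V : Type*} (π : V → ℕ) (S : Finset V) (c : V → V → ℕ)

/-- The colors on the pairs in `S` whose ends lie in different classes of `π`. -/
def crossColors : Finset ℕ :=
  ((S ×ˢ S).filter fun p => π p.1 ≠ π p.2).image fun p => c p.1 p.2

/-- The symmetric coloring `c` has no rainbow triangle among the vertices of `S`, in the complete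
multipartite graph given by the classes of `π`. -/
structure IsGallai : Prop where
  symm : ∀ u w, c u w = c w u
  no_rainbow : ∀ a ∈ S, ∀ b ∈ S, ∀ d ∈ S, π a ≠ π b → π b ≠ π d → π d ≠ π a →
    c a b = c b d ∨ c b d = c d a ∨ c a b = c d a

/-- A coloring without rainbow triangles using as many colors as possible. -/
structure IsExtremal : Prop extends IsGallai π S c where
  card_le : ∀ c', IsGallai π S c' → #(crossColors π S c') ≤ #(crossColors π S c)

/-- The members of `S` outside the class of `v`. -/
def others (v : V) : Finset V := S.filter fun u => π u ≠ π v

/-- The colors from `v` to other classes that do not occur away from the class of `v`. -/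
def newColors (v : V) : Finset ℕ :=
  (others π S v).image (c v) \ crossColors π (others π S v) c

/-- Replace each vertex in the class of `v` by a copy of `v`, where the colors in `newColors`
become distinct for distinct copies. -/
def clone (e : V → ℕ) (v u w : V) : ℕ :=
  Nat.pair (c (if π u = π v then v else u) (if π w = π v then v else w))
    (if c (if π u = π v then v else u) (if π w = π v then v else w) ∈
        crossColors π (others π S v) c then 0
      else (if π u = π v then e u + 1 else 0) + (if π w = π v then e w + 1 else 0))

variable {π S c}

lemma mem_crossColors {x : ℕ} :
    x ∈ crossColors π S c ↔ ∃ u ∈ S, ∃ w ∈ S, π u ≠ π w ∧ c u w = x := by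
  simp only [crossColors, mem_image, mem_filter, mem_product, Prod.exists]
  constructor
  · rintro ⟨u, w, ⟨⟨hu, hw⟩, h⟩, rfl⟩
    exact ⟨u, hu, w, hw, h, rfl⟩
  · rintro ⟨u, hu, w, hw, h, rfl⟩
    exact ⟨u, w, ⟨⟨hu, hw⟩, h⟩, rfl⟩

lemma mem_others {u v : V} : u ∈ others π S v ↔ u ∈ S ∧ π u ≠ π v := mem_filter

lemma others_congr {v w : V} (h : π v = π w) : others π S v = others π S w := by
  simp [others, h]

lemma IsGallai.mono {T : Finset V} (h : IsGallai π S c) (hT : T ⊆ S) : IsGallai π T c :=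
  ⟨h.symm, fun a ha b hb d hd => h.no_rainbow a (hT ha) b (hT hb) d (hT hd)⟩

lemma IsGallai.exists_isExtremal (h : IsGallai π S c) :
    ∃ c', IsExtremal π S c' ∧ #(crossColors π S c) ≤ #(crossColors π S c') := by
  let K : Set ℕ := {k | ∃ c', IsGallai π S c' ∧ #(crossColors π S c') = k}
  have hK : BddAbove K := by
    refine ⟨#(S ×ˢ S), ?_⟩
    rintro _ ⟨c', -, rfl⟩
    exact card_image_le.trans (card_filter_le _ _)
  obtain ⟨c', hc', hk⟩ := Nat.sSup_mem (s := K) ⟨_, c, h, rfl⟩ hK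
  have hle : ∀ c'', IsGallai π S c'' → #(crossColors π S c'') ≤ #(crossColors π S c') :=
    fun c'' h'' => hk ▸ le_csSup hK ⟨c'', h'', rfl⟩
  exact ⟨c', ⟨hc', hle⟩, hle c h⟩

lemma clone_of_others {e : V → ℕ} {v u w : V} (hu : u ∈ others π S v) (hw : w ∈ others π S v)
    (huw : π u ≠ π w) : clone π S c e v u w = Nat.pair (c u w) 0 := by
  have hx : c u w ∈ crossColors π (others π S v) c := mem_crossColors.2 ⟨u, hu, w, hw, huw, rfl⟩
  simp [clone, (mem_others.1 hu).2, (mem_others.1 hw).2, hx]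

lemma clone_of_class {e : V → ℕ} {v u w : V} (hu : π u = π v) (hw : w ∈ others π S v) :
    clone π S c e v u w =
      Nat.pair (c v w) (if c v w ∈ crossColors π (others π S v) c then 0 else e u + 1) := by
  simp [clone, hu, (mem_others.1 hw).2]

lemma clone_symm (h : ∀ u w, c u w = c w u) (e : V → ℕ) (v u w : V) :
    clone π S c e v u w = clone π S c e v w u := by
  unfold clone
  rw [h (if π u = π v then v else u), add_comm]

lemma IsGallai.clone (h : IsGallai π S c) (e : V → ℕ) {v : V} (hv : v ∈ S) :
    IsGallai π S (clone π S c e v) := by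
  have hsymm := clone_symm (π := π) (S := S) h.symm e v
  have key : ∀ a ∈ S, ∀ b ∈ S, ∀ d ∈ S, π a = π v → π a ≠ π b → π b ≠ π d → π d ≠ π a →
      _root_.clone π S c e v a b = _root_.clone π S c e v b d ∨
      _root_.clone π S c e v b d = _root_.clone π S c e v d a ∨
      _root_.clone π S c e v a b = _root_.clone π S c e v d a := by
    intro a ha b hb d hd hav hab hbd hda
    have hb' : b ∈ others π S v := mem_others.2 ⟨hb, fun h => hab (hav.trans h.symm)⟩
    have hd' : d ∈ others π S v := mem_others.2 ⟨hd, fun h => hda (h.trans hav.symm)⟩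
    have hx : c b d ∈ crossColors π (others π S v) c :=
      mem_crossColors.2 ⟨b, hb', d, hd', hbd, rfl⟩
    rw [hsymm d a, clone_of_class hav hb', clone_of_class hav hd', clone_of_others hb' hd' hbd]
    rcases h.no_rainbow v hv b hb d hd (hav ▸ hab) hbd (hav ▸ hda) with h1 | h1 | h1
    · left; simp [h1, hx]
    · right; left; rw [h.symm d v] at h1; simp [← h1, hx]
    · right; right; rw [h.symm d v] at h1; simp [h1]
  refine ⟨hsymm, fun a ha b hb d hd hab hbd hda => ?_⟩
  by_cases hav : π a = π v
  · exact key a ha b hb d hd hav hab hbd hda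
  by_cases hbv : π b = π v
  · have := key b hb d hd a ha hbv hbd hda hab
    tauto
  by_cases hdv : π d = π v
  · have := key d hd a ha b hb hdv hda hab hbd
    tauto
  have ha' : a ∈ others π S v := mem_others.2 ⟨ha, hav⟩
  have hb' : b ∈ others π S v := mem_others.2 ⟨hb, hbv⟩
  have hd' : d ∈ others π S v := mem_others.2 ⟨hd, hdv⟩
  rw [clone_of_others ha' hb' hab, clone_of_others hb' hd' hbd, clone_of_others hd' ha' hda]
  rcases h.no_rainbow a ha b hb d hd hab hbd hda with h1 | h1 | h1 <;> simp [h1]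

lemma card_crossColors_le_sum (h : ∀ u w, c u w = c w u) (v : V) :
    #(crossColors π S c) ≤ #(crossColors π (others π S v) c) +
      ∑ u ∈ S.filter (fun u => π u = π v), #(newColors π S c u) := by
  refine le_trans (card_le_card (t := crossColors π (others π S v) c ∪
    (S.filter (fun u => π u = π v)).biUnion (newColors π S c)) ?_)
    ((card_union_le _ _).trans (Nat.add_le_add_left card_biUnion_le _))
  intro x hx
  rw [mem_union, or_iff_not_imp_left]
  intro hx'
  have key : ∀ u ∈ S, ∀ w ∈ S, π u ≠ π w → c u w = x → π u = π v →
      x ∈ (S.filter (fun u => π u = π v)).biUnion (newColors π S c) := by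
    intro u hu w hw huw hc huv
    refine mem_biUnion.2 ⟨u, mem_filter.2 ⟨hu, huv⟩, mem_sdiff.2 ⟨?_, ?_⟩⟩
    · exact mem_image.2 ⟨w, mem_others.2 ⟨hw, huw.symm⟩, hc⟩
    · rwa [others_congr huv]
  obtain ⟨u, hu, w, hw, huw, hc⟩ := mem_crossColors.1 hx
  by_cases huv : π u = π v
  · exact key u hu w hw huw hc huv
  by_cases hwv : π w = π v
  · exact key w hw u hu huw.symm (h u w ▸ hc) hwv
  exact absurd (mem_crossColors.2
    ⟨u, mem_others.2 ⟨hu, huv⟩, w, mem_others.2 ⟨hw, hwv⟩, huw, hc⟩) hx'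

lemma card_crossColors_clone {e : V → ℕ} (he : Function.Injective e) (v : V) :
    #(crossColors π (others π S v) c) + #(S.filter fun u => π u = π v) * #(newColors π S c v) ≤
      #(crossColors π S (clone π S c e v)) := by
  let f : V × ℕ → ℕ := fun p => Nat.pair p.2 (e p.1 + 1)
  have hf : Function.Injective f := by
    rintro ⟨u, x⟩ ⟨w, y⟩ h
    obtain ⟨h1, h2⟩ := Nat.pair_eq_pair.1 h
    exact Prod.ext (he (Nat.succ_injective h2)) h1
  have hg : Function.Injective fun x => Nat.pair x 0 := fun x y h => (Nat.pair_eq_pair.1 h).1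
  rw [← card_image_of_injective (crossColors π (others π S v) c) hg, ← card_product,
    ← card_image_of_injective _ hf, ← card_union_of_disjoint]
  · refine card_le_card (union_subset ?_ ?_)
    · intro y hy
      obtain ⟨x, hx, rfl⟩ := mem_image.1 hy
      obtain ⟨u, hu, w, hw, huw, rfl⟩ := mem_crossColors.1 hx
      exact mem_crossColors.2 ⟨u, (mem_others.1 hu).1, w, (mem_others.1 hw).1, huw,
        clone_of_others hu hw huw⟩
    · intro y hy
      obtain ⟨⟨u, x⟩, hx, rfl⟩ := mem_image.1 hy
      obtain ⟨hu, hx⟩ := mem_product.1 hx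
      obtain ⟨hu, huv⟩ := mem_filter.1 hu
      obtain ⟨hx, hx'⟩ := mem_sdiff.1 hx
      obtain ⟨w, hw, hwx⟩ := mem_image.1 hx
      simp only at hwx hx' huv hu
      refine mem_crossColors.2 ⟨u, hu, w, (mem_others.1 hw).1,
        fun h => (mem_others.1 hw).2 (h.symm.trans huv), ?_⟩
      rw [clone_of_class huv hw, hwx, if_neg hx']
  · rw [disjoint_left]
    intro y hy hy'
    obtain ⟨x, -, rfl⟩ := mem_image.1 hy
    obtain ⟨p, -, hp⟩ := mem_image.1 hy'
    exact absurd (Nat.pair_eq_pair.1 hp).2 (by omega)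

lemma IsExtremal.card_eq {e : V → ℕ} (he : Function.Injective e) (h : IsExtremal π S c) {v : V}
    (hv : v ∈ S) : #(crossColors π S c) = #(crossColors π (others π S v) c) +
      #(S.filter fun u => π u = π v) * #(newColors π S c v) := by
  set A := S.filter fun u => π u = π v with hA
  have hvA : v ∈ A := mem_filter.2 ⟨hv, rfl⟩
  have hle : ∀ u ∈ A, #(crossColors π (others π S v) c) + #A * #(newColors π S c u) ≤
      #(crossColors π S c) := by
    intro u hu
    obtain ⟨hu, huv⟩ := mem_filter.1 hu
    have := (card_crossColors_clone (π := π) (S := S) (c := c) he u).trans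
      (h.card_le _ (h.toIsGallai.clone e hu))
    simpa only [others_congr huv, huv] using this
  have hsum := card_crossColors_le_sum (π := π) (S := S) h.symm v
  rw [← hA] at hsum
  have hcard : 0 < #A := card_pos.2 ⟨v, hvA⟩
  refine le_antisymm ?_ (hle v hvA)
  by_contra! hlt
  obtain ⟨u, hu, hmax⟩ := exists_max_image A (fun u => #(newColors π S c u)) ⟨v, hvA⟩
  have hstrict : ∑ w ∈ A, #(newColors π S c w) < ∑ _w ∈ A, #(newColors π S c u) := by
    refine sum_lt_sum hmax ⟨v, hvA, ?_⟩
    have h1 : #A * #(newColors π S c v) < ∑ w ∈ A, #(newColors π S c w) := by omega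
    have h2 := sum_le_card_nsmul A _ _ hmax
    rw [smul_eq_mul] at h2
    exact lt_of_mul_lt_mul_left (h1.trans_le h2) (Nat.zero_le _)
  rw [sum_const, smul_eq_mul] at hstrict
  have := hle u hu
  omega

lemma IsExtremal.clone {e : V → ℕ} (he : Function.Injective e) (h : IsExtremal π S c) {v : V}
    (hv : v ∈ S) : IsExtremal π S (clone π S c e v) where
  toIsGallai := h.toIsGallai.clone e hv
  card_le c' hc' := (h.card_le c' hc').trans
    ((h.card_eq he hv).le.trans (card_crossColors_clone he v))

/-- Two distinct new colors at `v` force every new color at `v` to lead to a single class. -/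
lemma IsGallai.exists_target (h : IsGallai π S c) {v : V} (hv : v ∈ S)
    (hnew : 1 < #(newColors π S c v)) : ∃ w ∈ others π S v,
      c v w ∉ crossColors π (others π S v) c ∧ ∀ u ∈ others π S v, c v u = c v w → π u = π w := by
  obtain ⟨x, hx, y, hy, hxy⟩ := one_lt_card.1 hnew
  obtain ⟨hx, hx'⟩ := mem_sdiff.1 hx
  obtain ⟨hy, hy'⟩ := mem_sdiff.1 hy
  obtain ⟨w, hw, rfl⟩ := mem_image.1 hx
  obtain ⟨z, hz, rfl⟩ := mem_image.1 hy
  have key : ∀ u ∈ others π S v, c v u = c v w → π u = π z := by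
    intro u hu huw
    by_contra hne
    have hmem : c u z ∈ crossColors π (others π S v) c :=
      mem_crossColors.2 ⟨u, hu, z, hz, hne, rfl⟩
    rcases h.no_rainbow v hv u (mem_others.1 hu).1 z (mem_others.1 hz).1
      (mem_others.1 hu).2.symm hne (mem_others.1 hz).2 with h1 | h1 | h1
    · exact hx' (huw ▸ h1 ▸ hmem)
    · rw [h.symm z v] at h1
      exact hy' (h1 ▸ hmem)
    · rw [h.symm z v] at h1
      exact hxy (huw.symm.trans h1)
  exact ⟨w, hw, hx', fun u hu huw => (key u hu huw).trans (key w hw rfl).symm⟩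

/-- After cloning `v` and then `w`, every color between their classes occurs on one edge only. -/
lemma clone_clone_unique (h : ∀ u w, c u w = c w u) {e : V → ℕ} (he : Function.Injective e)
    {v w : V} (hw : w ∈ others π S v) (hnew : c v w ∉ crossColors π (others π S v) c)
    (htarget : ∀ u ∈ others π S v, c v u = c v w → π u = π w) {a b p q : V}
    (ha : a ∈ S) (hav : π a = π v) (hbw : π b = π w)
    (hp : p ∈ S) (hq : q ∈ S) (hpq : π p ≠ π q) (hpv : π p ≠ π v)
    (heq : clone π S (clone π S c e v) e w p q = clone π S (clone π S c e v) e w a b) :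
    p = b ∧ q = a := by
  have hwv := (mem_others.1 hw).2
  set c₁ := clone π S c e v with hc₁
  have hs₁ : ∀ x y, c₁ x y = c₁ y x := clone_symm h e v
  have hcw : ∀ y, π y = π v → c₁ y w = Nat.pair (c v w) (e y + 1) := by
    intro y hy
    rw [hc₁, clone_of_class hy hw, if_neg hnew]
  have hback : ∀ x ∈ S, ∀ y ∈ S, π x ≠ π y → π x ≠ π v → c₁ x y = c₁ a w →
      π x = π w ∧ y = a := by
    intro x hx y hy hxy hxv hxya
    have hx' : x ∈ others π S v := mem_others.2 ⟨hx, hxv⟩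
    rw [hcw a hav] at hxya
    by_cases hyv : π y = π v
    · rw [hs₁, hc₁, clone_of_class hyv hx'] at hxya
      obtain ⟨h1, h2⟩ := Nat.pair_eq_pair.1 hxya
      rw [h1, if_neg hnew] at h2
      exact ⟨htarget x hx' h1, he (Nat.succ_injective h2)⟩
    · rw [hc₁, clone_of_others hx' (mem_others.2 ⟨hy, hyv⟩) hxy] at hxya
      exact absurd (Nat.pair_eq_pair.1 hxya).2 (by omega)
  have hnew₁ : c₁ a w ∉ crossColors π (others π S w) c₁ := by
    intro hmem
    obtain ⟨x, hx, y, hy, hxy, hxya⟩ := mem_crossColors.1 hmem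
    obtain ⟨hx, hxw⟩ := mem_others.1 hx
    obtain ⟨hy, hyw⟩ := mem_others.1 hy
    by_cases hxv : π x = π v
    · exact hyw (hback y hy x hx hxy.symm (hxv ▸ hxy.symm) ((hs₁ y x).trans hxya)).1
    · exact hxw (hback x hx y hy hxy hxv hxya).1
  have ha' : a ∈ others π S w := mem_others.2 ⟨ha, hav ▸ hwv.symm⟩
  rw [clone_symm hs₁ e w a b, clone_of_class hbw ha', hs₁ w a, if_neg hnew₁] at heq
  by_cases hpw : π p = π w
  · have hq' : q ∈ others π S w := mem_others.2 ⟨hq, hpw ▸ hpq.symm⟩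
    rw [clone_of_class hpw hq'] at heq
    obtain ⟨h1, h2⟩ := Nat.pair_eq_pair.1 heq
    rw [h1, if_neg hnew₁] at h2
    refine ⟨he (Nat.succ_injective h2), ?_⟩
    exact (hback w (mem_others.1 hw).1 q hq (mem_others.1 hq').2.symm hwv h1).2
  · have hp' : p ∈ others π S w := mem_others.2 ⟨hp, hpw⟩
    by_cases hqw : π q = π w
    · rw [clone_symm hs₁ e w p q, clone_of_class hqw hp', hs₁ w p] at heq
      exact absurd (hback p hp w (mem_others.1 hw).1 hpw hpv (Nat.pair_eq_pair.1 heq).1).1 hpw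
    · rw [clone_of_others hp' (mem_others.2 ⟨hq, hqw⟩) hpq] at heq
      exact absurd (Nat.pair_eq_pair.1 heq).2 (by omega)

variable [DecidableEq V]

/-- If every color between two classes occurs on one edge only, these classes may be contracted. -/
lemma IsGallai.card_le_contract (h : IsGallai π S c) {v w : V} (hv : v ∈ S) (hw : w ∈ S)
    (hvw : π v ≠ π w)
    (huniq : ∀ a ∈ S, π a = π v → ∀ b ∈ S, π b = π w → ∀ p ∈ S, ∀ q ∈ S, π p ≠ π q → π p ≠ π v →
      c p q = c a b → p = b ∧ q = a) :
    #(crossColors π S c) ≤ #(S.filter fun u => π u = π v) * #(S.filter fun u => π u = π w) +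
      #(crossColors π (insert v (S.filter fun u => π u ≠ π v ∧ π u ≠ π w)) c) := by
  have htri : ∀ y ∈ S, π y ≠ π v → π y ≠ π w → ∀ a ∈ S, π a = π v → ∀ b ∈ S, π b = π w →
      c y a = c y b := by
    intro y hy hyv hyw a ha hav b hb hbw
    have hne : π a ≠ π b := by rwa [hav, hbw]
    rcases h.no_rainbow a ha b hb y hy hne (hbw ▸ hyw.symm) (hav ▸ hyv) with h1 | h1 | h1
    · exact absurd (by rw [(huniq a ha hav b hb hbw y hy b hb (hbw ▸ hyw) hyv
        ((h.symm y b).trans h1.symm)).1, hbw]) hyw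
    · rw [← h1, h.symm]
    · exact absurd (by rw [(huniq a ha hav b hb hbw y hy a ha (hav ▸ hyv) hyv h1.symm).1, hbw]) hyw
  have hsame : ∀ y ∈ S, π y ≠ π v → π y ≠ π w → ∀ a ∈ S, π a = π v ∨ π a = π w →
      c y a = c y v := by
    intro y hy hyv hyw a ha ha'
    rcases ha' with ha' | ha'
    · rw [htri y hy hyv hyw a ha ha' w hw rfl, htri y hy hyv hyw v hv rfl w hw rfl]
    · rw [htri y hy hyv hyw v hv rfl a ha ha']
  rw [← card_product]
  refine le_trans (card_le_card (t := (S.filter (fun u => π u = π v) ×ˢ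
    S.filter (fun u => π u = π w)).image (fun p => c p.1 p.2) ∪
    crossColors π (insert v (S.filter fun u => π u ≠ π v ∧ π u ≠ π w)) c) ?_)
    ((card_union_le _ _).trans (Nat.add_le_add_right card_image_le _))
  have hin : ∀ p ∈ S, ∀ q ∈ S, π p = π v → π q = π w → c p q ∈
      (S.filter (fun u => π u = π v) ×ˢ S.filter (fun u => π u = π w)).image
        (fun p => c p.1 p.2) := by
    intro p hp q hq hpv hqw
    exact mem_image.2 ⟨(p, q),
      mem_product.2 ⟨mem_filter.2 ⟨hp, hpv⟩, mem_filter.2 ⟨hq, hqw⟩⟩, rfl⟩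
  have hout : ∀ p ∈ S, ∀ q ∈ S, π p ≠ π v → π p ≠ π w → π p ≠ π q →
      c p q ∈ crossColors π (insert v (S.filter fun u => π u ≠ π v ∧ π u ≠ π w)) c := by
    intro p hp q hq hpv hpw hpq
    have hp' : p ∈ insert v (S.filter fun u => π u ≠ π v ∧ π u ≠ π w) :=
      mem_insert_of_mem (mem_filter.2 ⟨hp, hpv, hpw⟩)
    by_cases hq' : π q = π v ∨ π q = π w
    · exact mem_crossColors.2 ⟨p, hp', v, mem_insert_self _ _, hpv,
        (hsame p hp hpv hpw q hq hq').symm⟩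
    · exact mem_crossColors.2 ⟨p, hp', q,
        mem_insert_of_mem (mem_filter.2 ⟨hq, not_or.1 hq'⟩), hpq, rfl⟩
  intro x hx
  obtain ⟨p, hp, q, hq, hpq, rfl⟩ := mem_crossColors.1 hx
  rw [mem_union]
  by_cases hpv : π p = π v
  · by_cases hqw : π q = π w
    · exact Or.inl (hin p hp q hq hpv hqw)
    · exact Or.inr (h.symm p q ▸ hout q hq p hp (hpv ▸ hpq.symm) hqw hpq.symm)
  · by_cases hpw : π p = π w
    · by_cases hqv : π q = π v
      · exact Or.inl (h.symm p q ▸ hin q hq p hp hqv hpw)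
      · exact Or.inr (h.symm p q ▸ hout q hq p hp hqv (hpw ▸ hpq.symm) hpq.symm)
    · exact Or.inr (hout p hp q hq hpv hpw hpq)

/-- Without a rainbow triangle, the number of colors is less than `pairSum` of the sizes of the
classes, in decreasing order. -/
theorem IsGallai.card_crossColors_lt_pairSum {e : V → ℕ} (he : Function.Injective e) :
    ∀ (k : ℕ) (l : List ℕ) (S : Finset V) (c : V → V → ℕ), l.length = k + 1 → l.Nodup →
      (l.map fun i => #(S.filter fun u => π u = i)).Pairwise (· ≥ ·) →
      (∀ i ∈ l, 1 ≤ #(S.filter fun u => π u = i)) → (∀ u ∈ S, π u ∈ l) → IsGallai π S c →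
      #(crossColors π S c) < pairSum (l.map fun i => #(S.filter fun u => π u = i)) := by
  intro k
  induction k with
  | zero =>
    intro l S c hlen _ _ hpos hmem _
    obtain ⟨i, rfl⟩ := List.length_eq_one_iff.1 hlen
    have : crossColors π S c = ∅ := by
      refine eq_empty_of_forall_notMem fun x hx => ?_
      obtain ⟨u, hu, w, hw, huw, -⟩ := mem_crossColors.1 hx
      have h1 := hmem u hu
      have h2 := hmem w hw
      simp only [List.mem_singleton] at h1 h2
      exact huw (h1.trans h2.symm)
    rw [this]
    simpa [pairSum] using hpos i (by simp)
  | succ k ih =>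
    intro l S c hlen hnd hsort hpos hmem hc
    obtain ⟨c, hext, hle⟩ := hc.exists_isExtremal
    refine hle.trans_lt ?_
    clear hle
    obtain ⟨i, s, rfl⟩ : ∃ i s, l = i :: s := by
      cases l with
      | nil => simp at hlen
      | cons i s => exact ⟨i, s, rfl⟩
    have hpos' : ∀ x ∈ (i :: s).map (fun i => #(S.filter fun u => π u = i)), 1 ≤ x := by
      intro x hx
      obtain ⟨j, hj, rfl⟩ := List.mem_map.1 hx
      exact hpos j hj
    obtain ⟨v, hv⟩ := card_pos.1 (hpos i (by simp))
    obtain ⟨hvS, rfl⟩ := mem_filter.1 hv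
    obtain ⟨hnot, hnd'⟩ := List.nodup_cons.1 hnd
    have hslen : s.length = k + 1 := by simpa using hlen
    by_cases hnew : 1 < #(newColors π S c v)
    · obtain ⟨w, hw, hwnew, htarget⟩ := hext.toIsGallai.exists_target hvS hnew
      obtain ⟨hwS, hwv⟩ := mem_others.1 hw
      have hext₂ := (hext.clone he hvS).clone he hwS
      refine (hext₂.card_le c hext.toIsGallai).trans_lt ?_
      have hcon := hext₂.toIsGallai.card_le_contract hvS hwS hwv.symm
        (fun a ha hav b _ hbw p hp q hq hpq hpv heq =>
          clone_clone_unique hext.symm he hw hwnew htarget ha hav hbw hp hq hpq hpv heq)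
      refine hcon.trans_lt ?_
      set c₂ := _root_.clone π S (_root_.clone π S c e v) e w
      set T := insert v (S.filter fun u => π u ≠ π v ∧ π u ≠ π w) with hT
      have hws : π w ∈ s := by
        have := hmem w hwS
        simp only [List.mem_cons] at this
        tauto
      obtain ⟨l₁, l₂, rfl⟩ := List.append_of_mem hws
      have hsplit : (l₁ ++ π w :: l₂).Perm (π w :: (l₁ ++ l₂)) := List.perm_middle
      obtain ⟨hnot₂, hnd₂⟩ := List.nodup_cons.1 (hsplit.nodup_iff.1 hnd')
      have hvl : π v ∉ l₁ ++ l₂ := fun h => hnot (hsplit.mem_iff.2 (List.mem_cons_of_mem _ h))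
      have hsize : ∀ j ∈ l₁ ++ l₂, #(T.filter fun u => π u = j) = #(S.filter fun u => π u = j) := by
        intro j hj
        congr 1
        ext u
        have h1 : j ≠ π v := fun h => hvl (h ▸ hj)
        have h2 : j ≠ π w := fun h => hnot₂ (h ▸ hj)
        simp only [hT, mem_filter, mem_insert]
        constructor
        · rintro ⟨rfl | ⟨h, -⟩, rfl⟩
          · exact absurd rfl h1
          · exact ⟨h, rfl⟩
        · rintro ⟨h, rfl⟩
          exact ⟨Or.inr ⟨h, h1, h2⟩, rfl⟩
      have hone : #(T.filter fun u => π u = π v) = 1 := by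
        rw [card_eq_one]
        refine ⟨v, ?_⟩
        ext u
        simp only [hT, mem_filter, mem_insert, mem_singleton]
        constructor
        · rintro ⟨h | h, h'⟩
          · exact h
          · exact absurd h' h.2.1
        · rintro rfl
          exact ⟨Or.inl rfl, rfl⟩
      have hmap : ((l₁ ++ l₂) ++ [π v]).map (fun i => #(T.filter fun u => π u = i)) =
          (l₁ ++ l₂).map (fun i => #(S.filter fun u => π u = i)) ++ [1] := by
        rw [List.map_append, List.map_congr_left hsize, List.map_singleton, hone]
      have hTS : T ⊆ S := insert_subset hvS (filter_subset _ _)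
      have hrest : ∀ j ∈ l₁ ++ l₂, 1 ≤ #(S.filter fun u => π u = j) := fun j hj =>
        hpos j (List.mem_cons_of_mem _ (hsplit.mem_iff.2 (List.mem_cons_of_mem _ hj)))
      have hbound := ih ((l₁ ++ l₂) ++ [π v]) T c₂ ?_ ?_ ?_ ?_ ?_ (hext₂.toIsGallai.mono hTS)
      · rw [hmap, pairSum_append_one] at hbound
        have hnum := mul_add_pairSum_le _ (l₁.map fun i => #(S.filter fun u => π u = i))
          #(S.filter fun u => π u = π w) (l₂.map fun i => #(S.filter fun u => π u = i))
          (by simpa only [List.map_cons, List.map_append] using hsort)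
          (by simpa only [List.map_cons, List.map_append] using hpos')
        simp only [List.map_cons, List.map_append] at hbound hnum ⊢
        omega
      · have := hsplit.length_eq
        simp only [List.length_append, List.length_cons, List.length_nil] at this hslen ⊢
        omega
      · exact List.nodup_append.2 ⟨hnd₂, List.nodup_singleton _, fun x hx y hy hxy =>
          hvl (List.mem_singleton.1 hy ▸ hxy ▸ hx)⟩
      · rw [hmap]
        refine List.pairwise_append.2 ⟨?_, List.pairwise_singleton _ _, ?_⟩
        · rw [List.map_cons] at hsort
          refine hsort.tail.sublist (List.Sublist.map _ ?_)
          exact List.Sublist.append (List.Sublist.refl _) (List.sublist_cons_self _ _)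
        · intro x hx y hy
          obtain ⟨j, hj, rfl⟩ := List.mem_map.1 hx
          rw [List.mem_singleton.1 hy]
          exact hrest j hj
      · intro j hj
        rcases List.mem_append.1 hj with hj | hj
        · exact hsize j hj ▸ hrest j hj
        · rw [List.mem_singleton.1 hj, hone]
      · intro u hu
        rcases mem_insert.1 hu with rfl | hu
        · simp
        · obtain ⟨hu, huv, huw⟩ := mem_filter.1 hu
          have := hmem u hu
          rw [List.mem_cons, hsplit.mem_iff, List.mem_cons] at this
          exact List.mem_append_left _ (by tauto)
    · have hcard := hext.card_eq he hvS
      have hsize : ∀ j ∈ s, #((others π S v).filter fun u => π u = j) =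
          #(S.filter fun u => π u = j) := by
        intro j hj
        congr 1
        ext u
        have h1 : j ≠ π v := fun h => hnot (h ▸ hj)
        simp only [others, mem_filter]
        constructor
        · rintro ⟨⟨h, -⟩, h'⟩
          exact ⟨h, h'⟩
        · rintro ⟨h, rfl⟩
          exact ⟨⟨h, h1⟩, rfl⟩
      have hmap := List.map_congr_left hsize
      rw [List.map_cons] at hsort hpos' ⊢
      have hbound := ih s (others π S v) c hslen hnd' (hmap ▸ hsort.tail)
        (fun j hj => hsize j hj ▸ hpos j (List.mem_cons_of_mem _ hj))
        (fun u hu => by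
          have := hmem u (mem_others.1 hu).1
          rw [List.mem_cons] at this
          exact this.resolve_left (mem_others.1 hu).2)
        (hext.toIsGallai.mono (filter_subset _ _))
      rw [hmap] at hbound
      have hnum := add_pairSum_le _ _ hsort hpos'
      have hmul := Nat.mul_le_mul_left #(S.filter fun u => π u = π v) (not_lt.1 hnew)
      omega

end Coloring

/-- Every edge-coloring of `K_{n₁,…,n_r}` with exactly `f(n₁,…,n_r) + 1` colors contains
a rainbow triangle. -/
theorem rainbow_C3_of_many_colors (r : ℕ) (n : ℕ → ℕ) (hr : 3 ≤ r)
    (hmono : ∀ i j : ℕ, i ≤ j → j < r → n j ≤ n i)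
    (hpos : ∀ i : ℕ, i < r → 1 ≤ n i)
    (c : Sym2 ((i : Fin r) × Fin (n i)) →
      Fin ((if Odd r then
             (∑ i ∈ Finset.range ((r - 1) / 2), n (2 * i) * n (2 * i + 1)) + n (r - 1)
               + (r - 1) / 2 - 1
            else
             (∑ i ∈ Finset.range (r / 2), n (2 * i) * n (2 * i + 1)) + r / 2 - 1) + 1))
    (hc : SurjOnEdges (Kpartite r n) c) :
    RainbowC3 (Kpartite r n) c := by
  by_contra hno
  let e : ((i : Fin r) × Fin (n i)) → ℕ := fun u => (Fintype.equivFin _ u : ℕ)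
  have he : Function.Injective e := Fin.val_injective.comp (Fintype.equivFin _).injective
  let π : ((i : Fin r) × Fin (n i)) → ℕ := fun u => u.1
  have hπ : ∀ u w, π u ≠ π w ↔ (Kpartite r n).Adj u w := fun u w => by
    simp [π, Kpartite, Fin.val_inj]
  have hsize : ∀ i ∈ List.range r, #(univ.filter fun u => π u = i) = n i := by
    intro i hi
    have hi : i < r := List.mem_range.1 hi
    have : (univ.filter fun u => π u = i) = univ.map (Function.Embedding.sigmaMk ⟨i, hi⟩) := by
      ext ⟨j, x⟩
      simp only [π, mem_filter, mem_univ, true_and, mem_map, Function.Embedding.sigmaMk_apply]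
      constructor
      · rintro rfl
        exact ⟨x, rfl⟩
      · rintro ⟨y, hy⟩
        rw [← (Sigma.mk.inj_iff.1 hy).1]
    rw [this, card_map, card_univ, Fintype.card_fin]
  have hmap := List.map_congr_left hsize
  have hg : IsGallai π univ fun u w => (c s(u, w) : ℕ) := by
    refine ⟨fun u w => by rw [Sym2.eq_swap], fun a _ b _ d _ hab hbd hda => ?_⟩
    by_contra! h
    exact hno ⟨a, b, d, (hπ a b).1 hab, (hπ b d).1 hbd, (hπ d a).1 hda,
      fun h' => h.1 (congrArg _ h'), fun h' => h.2.1 (congrArg _ h'),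
      fun h' => h.2.2 (congrArg _ h')⟩
  have hlt := IsGallai.card_crossColors_lt_pairSum he (r - 1) (List.range r) univ _
    (by rw [List.length_range]; omega) List.nodup_range
    (by
      rw [hmap]
      refine List.Pairwise.map (R := fun i j => i < j ∧ j < r) _
        (fun i j h => hmono i j h.1.le h.2) ?_
      exact List.pairwise_lt_range.imp_of_mem fun _ hj h => ⟨h, List.mem_range.1 hj⟩)
    (fun i hi => hsize i hi ▸ hpos i (List.mem_range.1 hi))
    (fun u _ => List.mem_range.2 u.1.2) hg
  rw [hmap, pairSum_map_range] at hlt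
  have hall := card_le_card (s := range _) (t := crossColors π univ fun u w => (c s(u, w) : ℕ))
    fun x hx => by
      obtain ⟨y, hy, hyx⟩ := hc ⟨x, mem_range.1 hx⟩
      induction y with
      | h u w =>
        exact mem_crossColors.2 ⟨u, mem_univ _, w, mem_univ _, (hπ u w).2 hy, by rw [hyx]⟩
  rw [card_range] at hall
  have hcount := hall.trans_lt hlt
  split_ifs at hcount <;> omega
end
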